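/- arXiv:2402.18693 — 2 statements merged into one kernel-verified Lean document; each statement's English description precedes it below -/
import Mathlib

section
/- Let k be a field of characteristic zero, X = (x_{ij}) an m×n matrix of independent indeterminates with m ≤ n, R = k[x_{ij} : 1 ≤ i ≤ m, 1 ≤ j ≤ n], and for 1 ≤ t ≤ m let I_t(X) be the ideal generated by all t×t minors of X. Then for every positive integer k and every integer 0 ≤ l ≤ m−t, α(I_t(X)^{(k(m−t+1)−l)}) = km − l. Moreover, the Waldschmidt constant of I_t(X) equals m/(m−t+1), i.e., α(I_t(X)^{(s)})/s → m/(m−t+1) as s → ∞. -/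
open MvPolynomial Filter

/-- The `s`-th symbolic power of an ideal: the intersection over the associated primes `p` of
`R ⧸ I` of the contractions of `I^s` localized at `p`. -/
noncomputable def symbolicPower {R : Type*} [CommRing R] (I : Ideal R) (s : ℕ) : Ideal R :=
  ⨅ p : {p : Ideal R // p ∈ associatedPrimes R (R ⧸ I)},
    letI : p.1.IsPrime := p.2.isPrime
    Ideal.comap (algebraMap R (Localization.AtPrime p.1))
      (Ideal.map (algebraMap R (Localization.AtPrime p.1)) (I ^ s))

/-- The least degree of a nonzero homogeneous element of an ideal of a polynomial ring. -/
noncomputable def alphaDeg {σ K : Type*} [CommSemiring K] (I : Ideal (MvPolynomial σ K)) : ℕ :=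
  sInf {d | ∃ f ∈ I, f ≠ 0 ∧ MvPolynomial.IsHomogeneous f d}

/-- The ideal `I_t(X)` generated by the `t × t` minors of the generic `m × n` matrix
`X = (x_{ij})` of indeterminates. -/
noncomputable def genericMinors (K : Type*) [Field K] (m n t : ℕ) :
    Ideal (MvPolynomial (Fin m × Fin n) K) :=
  Ideal.span {d | ∃ (r : Fin t → Fin m) (c : Fin t → Fin n),
    Function.Injective r ∧ Function.Injective c ∧
    d = Matrix.det (Matrix.of fun i j =>
      (MvPolynomial.X (r i, c j) : MvPolynomial (Fin m × Fin n) K))}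

section GenDet

variable {K : Type*} [Field K] {m n : ℕ}

theorem gd_minor_mem (t : ℕ) (r : Fin t → Fin m) (c : Fin t → Fin n) :
    Matrix.det (Matrix.of fun i j =>
      (MvPolynomial.X (r i, c j) : MvPolynomial (Fin m × Fin n) K)) ∈ genericMinors K m n t := by
  by_cases hr : Function.Injective r
  · by_cases hc : Function.Injective c
    · exact Ideal.subset_span ⟨r, c, hr, hc, rfl⟩
    · obtain ⟨i, j, hij, hne⟩ : ∃ i j, c i = c j ∧ i ≠ j := by
        simpa [Function.Injective] using hc
      rw [Matrix.det_zero_of_column_eq hne (by intro k; simp [hij])]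
      exact Ideal.zero_mem _
  · obtain ⟨i, j, hij, hne⟩ : ∃ i j, r i = r j ∧ i ≠ j := by
      simpa [Function.Injective] using hr
    rw [Matrix.det_zero_of_row_eq hne (by ext k; simp [hij])]
    exact Ideal.zero_mem _

theorem gd_leibniz_prod {R : Type*} [CommRing R] [Algebra K R] (D : Derivation K R R)
    {ι : Type*} [DecidableEq ι] (s : Finset ι) (g : ι → R) :
    D (∏ i ∈ s, g i) = ∑ i ∈ s, ∏ j ∈ s, Function.update g i (D (g i)) j := by
  induction s using Finset.induction_on with
  | empty => simp
  | insert a s ha ih =>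
    rw [Finset.prod_insert ha, D.leibniz, ih, Finset.sum_insert ha, Finset.prod_insert ha]
    have h1 : ∏ j ∈ s, Function.update g a (D (g a)) j = ∏ j ∈ s, g j := by
      apply Finset.prod_congr rfl
      intro j hj
      rw [Function.update_of_ne]
      rintro rfl; exact ha hj
    have h2 : ∑ i ∈ s, ∏ j ∈ insert a s, Function.update g i (D (g i)) j
        = ∑ i ∈ s, g a * ∏ j ∈ s, Function.update g i (D (g i)) j := by
      apply Finset.sum_congr rfl
      intro i hi
      rw [Finset.prod_insert ha, Function.update_of_ne]
      rintro rfl; exact ha hi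
    rw [h1, h2, Function.update_self, ← Finset.mul_sum]
    simp only [smul_eq_mul]
    ring

theorem gd_derivation_det {R : Type*} [CommRing R] [Algebra K R] (D : Derivation K R R)
    {t : ℕ} (M : Matrix (Fin t) (Fin t) R) :
    D M.det = ∑ i, (M.updateRow i (fun j => D (M i j))).det := by
  rw [← Matrix.det_transpose, Matrix.det_apply]
  simp only [map_sum]
  have : ∀ i, (M.updateRow i (fun j => D (M i j))).det =
      ∑ σ : Equiv.Perm (Fin t), Equiv.Perm.sign σ • ∏ j, (M.updateRow i (fun j => D (M i j))) j (σ j) := by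
    intro i
    rw [← Matrix.det_transpose, Matrix.det_apply]
    rfl
  simp only [this]
  rw [Finset.sum_comm]
  apply Finset.sum_congr rfl
  intro σ _
  rw [← Finset.smul_sum]
  have e : D (Equiv.Perm.sign σ • ∏ i, M.transpose (σ i) i)
      = Equiv.Perm.sign σ • D (∏ i, M.transpose (σ i) i) := by
    rcases Int.units_eq_one_or (Equiv.Perm.sign σ) with h | h <;> rw [h] <;> simp
  rw [e, gd_leibniz_prod]
  congr 1
  apply Finset.sum_congr rfl
  intro i _
  apply Finset.prod_congr rfl
  intro j _
  by_cases h : j = i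
  · subst h; simp
  · simp [Function.update_of_ne h, Matrix.updateRow_ne h]

/-- polarization -/
noncomputable def gdE (a b : Fin m) :
    Derivation K (MvPolynomial (Fin m × Fin n) K) (MvPolynomial (Fin m × Fin n) K) :=
  ∑ c : Fin n, (MvPolynomial.X (a, c) : MvPolynomial (Fin m × Fin n) K) • MvPolynomial.pderiv (b, c)

theorem gdE_apply (a b : Fin m) (f : MvPolynomial (Fin m × Fin n) K) :
    gdE a b f = ∑ c : Fin n, MvPolynomial.X (a, c) * MvPolynomial.pderiv (b, c) f := by
  rw [gdE, ← Derivation.coeFnAddMonoidHom_apply, map_sum, Finset.sum_apply]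
  rfl

theorem gdE_X (a b i : Fin m) (j : Fin n) :
    gdE a b (MvPolynomial.X (i, j) : MvPolynomial (Fin m × Fin n) K) =
      if i = b then MvPolynomial.X (a, j) else 0 := by
  rw [gdE_apply]
  simp only [MvPolynomial.pderiv_X]
  by_cases h : i = b
  · subst h
    rw [if_pos rfl, Finset.sum_eq_single j]
    · simp
    · intro c _ hc
      rw [Pi.single_eq_of_ne (by simp; tauto)]; simp
    · simp
  · rw [if_neg h]
    apply Finset.sum_eq_zero
    intro c _
    rw [Pi.single_eq_of_ne (by simp; tauto)]; simp

theorem gdE_mem (t : ℕ) (a b : Fin m) (f : MvPolynomial (Fin m × Fin n) K)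
    (hf : f ∈ genericMinors K m n t) : gdE a b f ∈ genericMinors K m n t := by
  unfold genericMinors at hf
  induction hf using Submodule.span_induction with
  | mem x hx =>
    obtain ⟨r, c, -, -, rfl⟩ := hx
    rw [gd_derivation_det]
    apply Ideal.sum_mem
    intro i _
    by_cases h : r i = b
    · have := gd_minor_mem (K := K) t (Function.update r i a) c
      convert this using 2
      ext1 k l
      by_cases hk : k = i
      · subst hk; simp [gdE_X, h]
      · simp [Matrix.updateRow_ne hk, Function.update_of_ne hk]
    · rw [Matrix.det_eq_zero_of_row_eq_zero i]
      · exact Ideal.zero_mem _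
      · intro j; simp [gdE_X, h]
  | zero => simp
  | add x y _ _ hx hy => rw [map_add]; exact Ideal.add_mem _ hx hy
  | smul a x hx ih =>
    rw [smul_eq_mul, Derivation.leibniz]
    apply Ideal.add_mem
    · exact Ideal.mul_mem_left _ _ ih
    · rw [smul_eq_mul]; exact Ideal.mul_mem_right _ _ hx

/-- normal ordered products of polarizations -/
noncomputable def gdN : List (Fin m × Fin m) → MvPolynomial (Fin m × Fin n) K →
    MvPolynomial (Fin m × Fin n) K
  | [], f => f
  | (p :: l), f => ∑ c : Fin n, MvPolynomial.X (p.1, c) * gdN l (MvPolynomial.pderiv (p.2, c) f)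

theorem gdN_add (l : List (Fin m × Fin m)) (f g : MvPolynomial (Fin m × Fin n) K) :
    gdN l (f + g) = gdN l f + gdN l g := by
  induction l generalizing f g with
  | nil => rfl
  | cons p l ih => simp [gdN, ih, mul_add, Finset.sum_add_distrib]

theorem gdN_zero (l : List (Fin m × Fin m)) :
    gdN l (0 : MvPolynomial (Fin m × Fin n) K) = 0 := by
  have := gdN_add l (0 : MvPolynomial (Fin m × Fin n) K) 0
  simpa using this

theorem gdN_nsmul (l : List (Fin m × Fin m)) (k : ℕ) (f : MvPolynomial (Fin m × Fin n) K) :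
    gdN l (k • f) = k • gdN l f := by
  induction k with
  | zero => simp [gdN_zero]
  | succ k ih => rw [succ_nsmul, succ_nsmul, gdN_add, ih]

theorem gdN_sum (l : List (Fin m × Fin m)) {ι : Type*} (s : Finset ι)
    (f : ι → MvPolynomial (Fin m × Fin n) K) :
    gdN l (∑ i ∈ s, f i) = ∑ i ∈ s, gdN l (f i) := by
  classical
  induction s using Finset.induction_on with
  | empty => simp [gdN_zero]
  | insert a s ha ih => rw [Finset.sum_insert ha, Finset.sum_insert ha, gdN_add, ih]

theorem gd_pderiv_comm (i j : Fin m × Fin n) (f : MvPolynomial (Fin m × Fin n) K) :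
    MvPolynomial.pderiv i (MvPolynomial.pderiv j f)
      = MvPolynomial.pderiv j (MvPolynomial.pderiv i f) := by
  have : ⁅(MvPolynomial.pderiv i :
      Derivation K (MvPolynomial (Fin m × Fin n) K) (MvPolynomial (Fin m × Fin n) K)),
      (MvPolynomial.pderiv j :
      Derivation K (MvPolynomial (Fin m × Fin n) K) (MvPolynomial (Fin m × Fin n) K))⁆ = 0 := by
    apply MvPolynomial.derivation_ext
    intro k
    rw [Derivation.commutator_apply]
    simp only [MvPolynomial.pderiv_X]
    have hz : ∀ i j k : Fin m × Fin n, MvPolynomial.pderiv i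
        ((Pi.single j 1 : Fin m × Fin n → MvPolynomial (Fin m × Fin n) K) k) = 0 := by
      intro i j k
      rw [Pi.single_apply]
      split_ifs <;> simp
    simp [hz]
  have h := congrArg (fun D : Derivation K (MvPolynomial (Fin m × Fin n) K)
    (MvPolynomial (Fin m × Fin n) K) => D f) this
  simp only [Derivation.commutator_apply] at h
  exact sub_eq_zero.mp h

theorem gdN_perm {l l' : List (Fin m × Fin m)} (h : l.Perm l')
    (f : MvPolynomial (Fin m × Fin n) K) : gdN l f = gdN l' f := by
  induction h generalizing f with
  | nil => rfl
  | cons x _ ih => simp [gdN, ih]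
  | swap x y l =>
    simp only [gdN, Finset.mul_sum]
    rw [Finset.sum_comm]
    apply Finset.sum_congr rfl; intro c _
    apply Finset.sum_congr rfl; intro c' _
    rw [gd_pderiv_comm]; ring
  | trans _ _ h1 h2 => rw [h1, h2]

/-- corrections -/
def gdCorr (a : Fin m) : List (Fin m × Fin m) → List (Fin m × List (Fin m × Fin m))
  | [] => []
  | (p :: l) => (if p.2 = a then [(p.1, l)] else []) ++
      (gdCorr a l).map (fun q => (q.1, p :: q.2))

theorem gdCorr_length (a : Fin m) (l : List (Fin m × Fin m)) :
    ∀ q ∈ gdCorr a l, q.2.length + 1 = l.length := by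
  induction l with
  | nil => simp [gdCorr]
  | cons p l ih =>
    intro q hq
    simp only [gdCorr, List.mem_append, List.mem_map] at hq
    rcases hq with hq | ⟨q', hq', rfl⟩
    · split_ifs at hq
      · simp at hq; subst hq; rfl
      · simp at hq
    · have := ih q' hq'
      simpa using this

theorem gdCorr_nil (a : Fin m) (l : List (Fin m × Fin m)) (h : ∀ p ∈ l, p.2 ≠ a) :
    gdCorr a l = [] := by
  induction l with
  | nil => rfl
  | cons p l ih =>
    simp only [gdCorr]
    rw [if_neg (h p (by simp)), ih (fun p hp => h p (by simp [hp]))]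
    rfl

theorem gdN_X_mul (a : Fin m) (c : Fin n) (l : List (Fin m × Fin m))
    (g : MvPolynomial (Fin m × Fin n) K) :
    gdN l (MvPolynomial.X (a, c) * g) = MvPolynomial.X (a, c) * gdN l g +
      ((gdCorr a l).map (fun q => MvPolynomial.X (q.1, c) * gdN q.2 g)).sum := by
  induction l generalizing g with
  | nil => simp [gdN, gdCorr]
  | cons p l ih =>
    have key : ∀ c', gdN l (MvPolynomial.pderiv (p.2, c') (MvPolynomial.X (a, c) * g)) =
        (if (a, c) = (p.2, c') then gdN l g else 0) +
        (MvPolynomial.X (a, c) * gdN l (MvPolynomial.pderiv (p.2, c') g) +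
      ((gdCorr a l).map (fun q => MvPolynomial.X (q.1, c) *
        gdN q.2 (MvPolynomial.pderiv (p.2, c') g))).sum) := by
      intro c'
      rw [Derivation.leibniz, add_comm, gdN_add, smul_eq_mul, smul_eq_mul, ih,
        MvPolynomial.pderiv_X]
      congr 1
      by_cases h : (a, c) = (p.2, c')
      · rw [if_pos h, ← h]; simp
      · rw [if_neg h, Pi.single_eq_of_ne h]; simp [gdN_zero]
    simp only [gdN, key, gdCorr, List.map_append, List.sum_append, List.map_map, mul_add,
      Finset.sum_add_distrib]
    have e1 : ∑ x, MvPolynomial.X (p.1, x) * (if (a, c) = (p.2, x) then gdN l g else 0)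
      = (List.map (fun q ↦ MvPolynomial.X (q.1, c) * gdN q.2 g)
          (if p.2 = a then [(p.1, l)] else [])).sum := by
      by_cases h : p.2 = a
      · simp [h, Prod.ext_iff]
      · have : a ≠ p.2 := fun e => h e.symm
        simp [h, Prod.ext_iff, this]
    have e2 : ∑ x, MvPolynomial.X (p.1, x) * ((gdCorr a l).map (fun q => MvPolynomial.X (q.1, c) *
        gdN q.2 (MvPolynomial.pderiv (p.2, x) g))).sum
        = ((gdCorr a l).map ((fun q ↦ MvPolynomial.X (q.1, c) * gdN q.2 g) ∘
          (fun q => (q.1, p :: q.2)))).sum := by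
      generalize gdCorr a l = L
      induction L with
      | nil => simp
      | cons q L ih =>
        simp only [List.map_cons, List.sum_cons, mul_add, Finset.sum_add_distrib, ih]
        congr 1
        simp only [Function.comp, gdN, Finset.mul_sum]
        apply Finset.sum_congr rfl; intro _ _; ring
    have e3 : ∑ x, MvPolynomial.X (p.1, x) * (MvPolynomial.X (a, c) *
          gdN l (MvPolynomial.pderiv (p.2, x) g))
        = MvPolynomial.X (a, c) * ∑ x, MvPolynomial.X (p.1, x) *
          gdN l (MvPolynomial.pderiv (p.2, x) g) := by
      rw [Finset.mul_sum]
      apply Finset.sum_congr rfl; intro _ _; ring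
    rw [e1, e2, e3]
    ring

theorem gdN_E (a b : Fin m) (l : List (Fin m × Fin m)) (f : MvPolynomial (Fin m × Fin n) K) :
    gdN l (gdE a b f) = gdN ((a, b) :: l) f +
      ((gdCorr a l).map (fun q => gdN ((q.1, b) :: q.2) f)).sum := by
  rw [gdE_apply, gdN_sum]
  simp only [gdN_X_mul, Finset.sum_add_distrib]
  congr 1
  generalize gdCorr a l = L
  induction L with
  | nil => simp
  | cons q L ih =>
    simp only [List.map_cons, List.sum_cons, Finset.sum_add_distrib, ih]
    rfl

theorem gdN_mem (t : ℕ) (N : ℕ) : ∀ (l : List (Fin m × Fin m)), l.length = N →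
    ∀ f ∈ genericMinors K m n t, gdN l f ∈ genericMinors K m n t := by
  induction N with
  | zero => intro l hl f hf; rw [List.length_eq_zero_iff] at hl; subst hl; exact hf
  | succ N ih =>
    intro l hl f hf
    cases l with
    | nil => simp at hl
    | cons p l =>
      have hl' : l.length = N := by simpa using hl
      have h := gdN_E p.1 p.2 l f
      replace h := eq_sub_of_add_eq h.symm
      change gdN ((p.1, p.2) :: l) f ∈ _
      rw [h]
      apply Ideal.sub_mem
      · exact ih l hl' _ (gdE_mem t _ _ f hf)
      · apply list_sum_mem
        intro x hx
        rw [List.mem_map] at hx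
        obtain ⟨q, hq, rfl⟩ := hx
        have := gdCorr_length p.1 l q hq
        exact ih _ (by simp; omega) f hf

end GenDet
section GenDet2

variable {K : Type*} [Field K] {m n : ℕ}

noncomputable def gdNS {t : ℕ} (b : Fin t → Fin m) (S : Finset (Fin t)) (σ : Equiv.Perm (Fin t))
    (f : MvPolynomial (Fin m × Fin n) K) : MvPolynomial (Fin m × Fin n) K :=
  gdN (S.toList.map fun j => (b (σ j), b j)) f

theorem gdNS_insert {t : ℕ} (b : Fin t → Fin m) (S : Finset (Fin t)) (σ : Equiv.Perm (Fin t))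
    (f : MvPolynomial (Fin m × Fin n) K) (r : Fin t) (hr : r ∉ S) :
    gdNS b (insert r S) σ f = gdN ((b (σ r), b r) :: S.toList.map fun j => (b (σ j), b j)) f :=
  gdN_perm ((Finset.toList_insert hr).map _) f

theorem gd_step_fix {t : ℕ} (b : Fin t → Fin m) (hb : StrictMono b) (d : Fin m → ℕ)
    (f : MvPolynomial (Fin m × Fin n) K) (h1 : ∀ r, gdE r r f = d r • f)
    (S : Finset (Fin t)) (r : Fin t) (hr : r ∉ S) (σ : Equiv.Perm (Fin t)) (hσ : σ r = r) :
    gdNS b (insert r S) σ f = d (b r) • gdNS b S σ f := by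
  rw [gdNS_insert b S σ f r hr, hσ]
  have h := gdN_E (b r) (b r) (S.toList.map fun j => (b (σ j), b j)) f
  rw [gdCorr_nil, h1, gdN_nsmul] at h
  · simpa [gdNS] using h.symm
  · intro p hp
    simp only [List.mem_map, Finset.mem_toList] at hp
    obtain ⟨j, hj, rfl⟩ := hp
    intro e
    exact hr (hb.injective e ▸ hj)

theorem gd_step_move {t : ℕ} (T : ℕ) (b : Fin t → Fin m) (hb : StrictMono b)
    (f : MvPolynomial (Fin m × Fin n) K)
    (h2 : ∀ k r : Fin m, k < r → gdE k r f ∈ genericMinors K m n T)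
    (S : Finset (Fin t)) (r k : Fin t) (hr : r ∉ S) (hk : k ∉ S) (hkr : k < r)
    (σ : Equiv.Perm (Fin t)) (hσ : σ r = k) :
    gdNS b (insert r (insert k S)) σ f + gdNS b (insert r S) (σ * Equiv.swap k r) f
      ∈ genericMinors K m n T := by
  have hr' : r ∉ insert k S := by simp [hr, hkr.ne']
  rw [gdNS_insert b _ σ f r hr', gdNS_insert b S _ f r hr, hσ]
  have p1 : ((b k, b r) :: (insert k S).toList.map fun j => (b (σ j), b j)).Perm
      ((b k, b r) :: (b (σ k), b k) :: S.toList.map fun j => (b (σ j), b j)) :=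
    List.Perm.cons _ ((Finset.toList_insert hk).map _)
  rw [gdN_perm p1]
  have p2 : (S.toList.map fun j => (b ((σ * Equiv.swap k r) j), b j)) =
      S.toList.map fun j => (b (σ j), b j) := by
    apply List.map_congr_left
    intro j hj
    rw [Finset.mem_toList] at hj
    rw [Equiv.Perm.mul_apply, Equiv.swap_apply_of_ne_of_ne]
    · rintro rfl; exact hk hj
    · rintro rfl; exact hr hj
  rw [p2]
  have h := gdN_E (b k) (b r) ((b (σ k), b k) :: S.toList.map fun j => (b (σ j), b j)) f
  rw [gdCorr, gdCorr_nil] at h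
  · simp only [if_true, List.map_nil, List.append_nil, List.map_cons, List.sum_cons,
      List.sum_nil, add_zero] at h
    have e : (σ * Equiv.swap k r) r = σ k := by simp
    rw [e, ← h]
    exact gdN_mem T _ _ rfl _ (h2 _ _ (hb hkr))
  · intro p hp
    simp only [List.mem_map, Finset.mem_toList] at hp
    obtain ⟨j, hj, rfl⟩ := hp
    intro e
    exact hk (hb.injective e ▸ hj)

theorem gd_capelli {t : ℕ} (T : ℕ) (b : Fin t → Fin m) (hb : StrictMono b) (d : Fin m → ℕ)
    (f : MvPolynomial (Fin m × Fin n) K) (h1 : ∀ r, gdE r r f = d r • f)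
    (h2 : ∀ k r : Fin m, k < r → gdE k r f ∈ genericMinors K m n T) (N : ℕ) :
    ∀ S : Finset (Fin t), S.card = N → ∃ ν : Equiv.Perm (Fin t) → ℕ,
      (∀ σ : Equiv.Perm (Fin t), (∀ j ∉ S, σ j = j) →
        ((Equiv.Perm.sign σ : ℤˣ) : ℤ) • gdNS b S σ f - ν σ • f ∈ genericMinors K m n T) ∧
      (∀ r ∈ S, (∀ i ∈ S, i ≤ r) → 0 < d (b r) →
        ∃ σ : Equiv.Perm (Fin t), (∀ j ∉ S, σ j = j) ∧ 0 < ν σ) ∧ (S = ∅ → ∀ σ, 0 < ν σ) := by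
  induction N with
  | zero =>
    intro S hS
    rw [Finset.card_eq_zero] at hS
    subst hS
    refine ⟨fun _ => 1, ?_, by simp, by simp⟩
    intro σ hσ
    have : σ = 1 := by ext1 j; exact hσ j (by simp)
    subst this
    simp [gdNS, gdN]
  | succ N ih =>
    intro S hS
    have ih' : ∀ S : Finset (Fin t), ∃ ν : Equiv.Perm (Fin t) → ℕ, S.card = N →
      (∀ σ : Equiv.Perm (Fin t), (∀ j ∉ S, σ j = j) →
        ((Equiv.Perm.sign σ : ℤˣ) : ℤ) • gdNS b S σ f - ν σ • f ∈ genericMinors K m n T) ∧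
      (∀ r ∈ S, (∀ i ∈ S, i ≤ r) → 0 < d (b r) →
        ∃ σ : Equiv.Perm (Fin t), (∀ j ∉ S, σ j = j) ∧ 0 < ν σ) ∧ (S = ∅ → ∀ σ, 0 < ν σ) := by
      intro S
      by_cases h : S.card = N
      · obtain ⟨ν, hν⟩ := ih S h
        exact ⟨ν, fun _ => hν⟩
      · exact ⟨fun _ => 0, fun h' => absurd h' h⟩
    choose ν hν using ih'
    have hne : S.Nonempty := by rw [← Finset.card_pos]; omega
    obtain ⟨r, hrS, hmax⟩ : ∃ r ∈ S, ∀ i ∈ S, i ≤ r :=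
      ⟨S.max' hne, S.max'_mem hne, fun i hi => S.le_max' i hi⟩
    have hcard : ∀ k ∈ S, (S.erase k).card = N := by
      intro k hk; rw [Finset.card_erase_of_mem hk, hS]; rfl
    refine ⟨fun σ => if σ r = r then d (b r) * ν (S.erase r) σ else
      ν (S.erase (σ r)) (σ * Equiv.swap (σ r) r), ?_, ?_, fun h => absurd h hne.ne_empty⟩
    · intro σ hσ
      by_cases h : σ r = r
      · simp only [h, if_true]
        have e : S = insert r (S.erase r) := (Finset.insert_erase hrS).symm
        have e2 : gdNS b S σ f = d (b r) • gdNS b (S.erase r) σ f := by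
          conv_lhs => rw [e]
          exact gd_step_fix b hb d f h1 _ r (by simp) σ h
        rw [e2]
        have h3 := (hν (S.erase r) (hcard r hrS)).1 σ (by
          intro j hj
          by_cases hj' : j = r
          · rw [hj', h]
          · exact hσ j (fun hjS => hj (Finset.mem_erase.mpr ⟨hj', hjS⟩)))
        have h4 := Ideal.mul_mem_left _ (d (b r) : MvPolynomial (Fin m × Fin n) K) h3
        convert h4 using 1
        simp only [zsmul_eq_mul, nsmul_eq_mul]
        push_cast
        ring
      · simp only [h, if_false]
        set k := σ r with hk
        have hkS : k ∈ S := by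
          by_contra hkS
          have := hσ k hkS
          rw [hk] at this
          exact h (by rw [hk]; exact σ.injective this)
        have hkr : k < r := lt_of_le_of_ne (hmax k hkS) h
        have hrk : r ∈ S.erase k := Finset.mem_erase.mpr ⟨hkr.ne', hrS⟩
        have e1 : insert r ((S.erase k).erase r) = S.erase k := Finset.insert_erase hrk
        have e2 : insert r (insert k ((S.erase k).erase r)) = S := by
          rw [Finset.insert_comm, e1, Finset.insert_erase hkS]
        have h3 := gd_step_move T b hb f h2 ((S.erase k).erase r) r k (by simp) (by simp) hkr σ
          hk.symm
        rw [e1, e2] at h3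
        have h4 := (hν (S.erase k) (hcard k hkS)).1 (σ * Equiv.swap k r) (by
          intro j hj
          by_cases hj' : j = k
          · subst hj'; simp [hk]
          · have hjS : j ∉ S := fun hjS => hj (Finset.mem_erase.mpr ⟨hj', hjS⟩)
            have : j ≠ r := by rintro rfl; exact hjS hrS
            rw [Equiv.Perm.mul_apply, Equiv.swap_apply_of_ne_of_ne hj' this]
            exact hσ j hjS)
        have hs : ((Equiv.Perm.sign (σ * Equiv.swap k r) : ℤˣ) : ℤ)
            = -((Equiv.Perm.sign σ : ℤˣ) : ℤ) := by
          rw [Equiv.Perm.sign_mul, Equiv.Perm.sign_swap h]; simp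
        rw [hs] at h4
        have h5 := Ideal.mul_mem_left _ ((((Equiv.Perm.sign σ : ℤˣ) : ℤ)) : MvPolynomial (Fin m × Fin n) K) h3
        have h6 := Ideal.add_mem _ h4 h5
        convert h6 using 1
        simp only [zsmul_eq_mul, nsmul_eq_mul]
        push_cast
        ring
    · intro r' hr' hmax' hd
      have : r' = r := le_antisymm (hmax r' hr') (hmax' r hrS)
      subst this
      by_cases hN : S.erase r' = ∅
      · refine ⟨1, by simp, ?_⟩
        have h0 := (hν (S.erase r') (hcard r' hr'))
        simp only [Equiv.Perm.one_apply, if_true]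
        exact Nat.mul_pos hd (h0.2.2 hN 1)
      · obtain ⟨k, hk⟩ := Finset.nonempty_iff_ne_empty.mpr hN
        have hkS : k ∈ S := Finset.mem_of_mem_erase hk
        have hkr : k ≠ r' := Finset.ne_of_mem_erase hk
        obtain ⟨σ, hσ, hpos⟩ := (hν (S.erase k) (hcard k hkS)).2.1 r'
          (Finset.mem_erase.mpr ⟨hkr.symm, hr'⟩)
          (fun i hi => hmax i (Finset.mem_of_mem_erase hi)) hd
        have hσk : σ k = k := hσ k (by simp)
        refine ⟨σ * Equiv.swap k r', ?_, ?_⟩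
        · intro j hj
          have h1 : j ≠ k := by rintro rfl; exact hj hkS
          have h2 : j ≠ r' := by rintro rfl; exact hj hr'
          rw [Equiv.Perm.mul_apply, Equiv.swap_apply_of_ne_of_ne h1 h2]
          exact hσ j (fun h => hj (Finset.mem_of_mem_erase h))
        · simp only [Equiv.Perm.mul_apply, Equiv.swap_apply_right, hσk, hkr, if_false]
          rw [mul_assoc, Equiv.swap_mul_self, mul_one]
          exact hpos

end GenDet2
section GenDet3

variable {K : Type*} [Field K] {m n : ℕ}

theorem gd_exists_D (t : ℕ) (v : Fin t → Fin m) (f : MvPolynomial (Fin m × Fin n) K) :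
    ∃ D : (Fin t → Fin n) → MvPolynomial (Fin m × Fin n) K, ∀ u : Fin t → Fin m,
      gdN (List.ofFn fun j => (u j, v j)) f =
        ∑ c : Fin t → Fin n, (∏ j, MvPolynomial.X (u j, c j)) * D c := by
  induction t generalizing f with
  | zero => exact ⟨fun _ => f, fun u => by simp [gdN]⟩
  | succ t ih =>
    have := fun c : Fin n => ih (fun j => v j.succ) (MvPolynomial.pderiv (v 0, c) f)
    choose D hD using this
    refine ⟨fun c => D (c 0) (fun j => c j.succ), fun u => ?_⟩
    rw [List.ofFn_succ]
    simp only [gdN, hD]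
    rw [← (Fin.consEquiv (fun _ : Fin (t+1) => Fin n)).sum_comp, Fintype.sum_prod_type]
    apply Finset.sum_congr rfl; intro c _
    rw [Finset.mul_sum]
    apply Finset.sum_congr rfl; intro c' _
    rw [Fin.prod_univ_succ]
    simp [Fin.consEquiv, mul_assoc]

theorem gd_cap_mem (t : ℕ) (b : Fin t → Fin m) (f : MvPolynomial (Fin m × Fin n) K) :
    ∑ σ : Equiv.Perm (Fin t), ((Equiv.Perm.sign σ : ℤˣ) : ℤ) • gdNS b Finset.univ σ f
      ∈ genericMinors K m n t := by
  obtain ⟨D, hD⟩ := gd_exists_D t b f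
  have h1 : ∀ σ : Equiv.Perm (Fin t), gdNS b Finset.univ σ f =
      ∑ c : Fin t → Fin n, (∏ j, MvPolynomial.X (b (σ j), c j)) * D c := by
    intro σ
    rw [← hD (fun j => b (σ j)), gdNS]
    apply gdN_perm
    rw [List.ofFn_eq_map]
    apply List.Perm.map
    rw [List.perm_ext_iff_of_nodup (Finset.nodup_toList _) (List.nodup_finRange t)]
    simp
  simp only [h1, Finset.smul_sum]
  rw [Finset.sum_comm]
  apply Ideal.sum_mem
  intro c _
  have h2 := Ideal.mul_mem_right (D c) _ (gd_minor_mem (K := K) t b c)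
  rw [Matrix.det_apply, Finset.sum_mul] at h2
  convert h2 using 2 with σ
  rw [Units.smul_def, smul_mul_assoc]
  rfl

theorem gd_hw_mem [CharZero K] (t : ℕ) (ht : 1 ≤ t) (d : Fin m → ℕ)
    (f : MvPolynomial (Fin m × Fin n) K) (h1 : ∀ r, gdE r r f = d r • f)
    (h2 : ∀ k r : Fin m, k < r → gdE k r f ∈ genericMinors K m n t)
    (r : Fin m) (hr : t ≤ r.val + 1) (hd : 0 < d r) : f ∈ genericMinors K m n t := by
  let b : Fin t → Fin m := fun j => ⟨r.val + 1 - t + j.val, by omega⟩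
  have hb : StrictMono b := by
    intro i j hij
    simp only [b, Fin.lt_def] at *
    omega
  obtain ⟨ν, hν, hpos, -⟩ := gd_capelli t b hb d f h1 h2 _ Finset.univ rfl
  obtain ⟨σ, -, hσ⟩ := hpos ⟨t - 1, by omega⟩ (by simp)
    (by intro i _; rw [Fin.le_def]; simp; omega)
    (by
      have : b ⟨t - 1, by omega⟩ = r := by ext; simp [b]; omega
      rw [this]; exact hd)
  have h3 : ∑ σ : Equiv.Perm (Fin t), (((Equiv.Perm.sign σ : ℤˣ) : ℤ) • gdNS b Finset.univ σ f
      - ν σ • f) ∈ genericMinors K m n t := Ideal.sum_mem _ (fun σ _ => hν σ (by simp))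
  rw [Finset.sum_sub_distrib, ← Finset.sum_smul] at h3
  have h4 := Ideal.sub_mem _ (gd_cap_mem t b f) h3
  rw [sub_sub_cancel, nsmul_eq_mul] at h4
  have hne : ((∑ σ, ν σ : ℕ) : K) ≠ 0 := by
    rw [Nat.cast_ne_zero]
    exact (Finset.sum_pos' (fun _ _ => Nat.zero_le _) ⟨σ, Finset.mem_univ _, hσ⟩).ne'
  have h5 := Ideal.mul_mem_left _ (MvPolynomial.C (((∑ σ, ν σ : ℕ) : K)⁻¹)) h4
  rw [← mul_assoc, ← map_natCast (MvPolynomial.C), ← map_mul, inv_mul_cancel₀ hne] at h5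
  simpa using h5

noncomputable def gdPhi (K : Type*) [Field K] (m n q : ℕ) : MvPolynomial (Fin m × Fin n) K →ₐ[K]
    MvPolynomial (Fin m × Fin q ⊕ Fin q × Fin n) K :=
  MvPolynomial.aeval fun p => ∑ k, MvPolynomial.X (Sum.inl (p.1, k)) * MvPolynomial.X (Sum.inr (k, p.2))

noncomputable def gdEY (q : ℕ) (a b : Fin m) :
    Derivation K (MvPolynomial (Fin m × Fin q ⊕ Fin q × Fin n) K)
      (MvPolynomial (Fin m × Fin q ⊕ Fin q × Fin n) K) :=
  MvPolynomial.mkDerivation K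
    (Sum.elim (fun p => if p.1 = b then MvPolynomial.X (Sum.inl (a, p.2)) else 0) (fun _ => 0))

theorem gdPhi_E (q : ℕ) (a b : Fin m) (f : MvPolynomial (Fin m × Fin n) K) :
    gdPhi K m n q (gdE a b f) = gdEY q a b (gdPhi K m n q f) := by
  induction f using MvPolynomial.induction_on with
  | C c =>
    rw [MvPolynomial.derivation_C]
    have : gdPhi K m n q (MvPolynomial.C c) = MvPolynomial.C c := by
      simp [gdPhi, MvPolynomial.algebraMap_eq]
    rw [this, MvPolynomial.derivation_C, map_zero]
  | add f g hf hg => simp only [map_add, hf, hg]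
  | mul_X f p hf =>
    rw [Derivation.leibniz, map_mul (gdPhi K m n q), Derivation.leibniz, map_add, smul_eq_mul, smul_eq_mul,
      map_mul, map_mul, hf, smul_eq_mul, smul_eq_mul]
    congr 2
    obtain ⟨i, j⟩ := p
    rw [gdE_X]
    have h : ∀ i j, gdPhi K m n q (MvPolynomial.X (i, j)) =
      ∑ k, MvPolynomial.X (Sum.inl (i, k)) * MvPolynomial.X (Sum.inr (k, j)) := by
      intro i j; simp [gdPhi]
    rw [h, map_sum]
    simp only [Derivation.leibniz, gdEY, MvPolynomial.mkDerivation_X, Sum.elim_inl, Sum.elim_inr,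
      smul_zero, zero_add]
    split_ifs with hi
    · rw [h]
      apply Finset.sum_congr rfl; intro k _
      rw [smul_eq_mul, mul_comm]
    · simp

/-- row weights -/
def gdw (m n : ℕ) : Fin m × Fin n → (Fin m → ℕ) := fun p => Pi.single p.1 1

def gdw' (m n q : ℕ) : Fin m × Fin q ⊕ Fin q × Fin n → (Fin m → ℕ) :=
  Sum.elim (fun p => Pi.single p.1 1) (fun _ => 0)

theorem gdPhi_homog (q : ℕ) (d : Fin m → ℕ) (f : MvPolynomial (Fin m × Fin n) K)
    (hf : IsWeightedHomogeneous (gdw m n) f d) :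
    IsWeightedHomogeneous (gdw' m n q) (gdPhi K m n q f) d := by
  rw [f.as_sum, map_sum]
  apply IsWeightedHomogeneous.sum
  intro s hs
  have hs' := hf (MvPolynomial.mem_support_iff.mp hs)
  rw [gdPhi, MvPolynomial.aeval_monomial, MvPolynomial.algebraMap_eq]
  apply IsWeightedHomogeneous.C_mul
  rw [← hs', Finsupp.weight_apply, Finsupp.prod, Finsupp.sum]
  apply IsWeightedHomogeneous.prod
  intro p _
  apply IsWeightedHomogeneous.pow
  apply IsWeightedHomogeneous.sum
  intro k _
  have := (isWeightedHomogeneous_X K (gdw' m n q) (Sum.inl (p.1, k))).mul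
    (isWeightedHomogeneous_X K (gdw' m n q) (Sum.inr (k, p.2)))
  simpa [gdw', gdw] using this

theorem gdPhi_comp (q : ℕ) (d : Fin m → ℕ) (f : MvPolynomial (Fin m × Fin n) K)
    (hf : gdPhi K m n q f = 0) :
    gdPhi K m n q (weightedHomogeneousComponent (gdw m n) d f) = 0 := by
  classical
  have h0 := finsum_weightedHomogeneousComponent (gdw m n) f
  have hfin := weightedHomogeneousComponent_finsupp (w := gdw m n) f
  rw [finsum_eq_sum _ hfin] at h0
  have h1 := congrArg (fun g => weightedHomogeneousComponent (gdw' m n q) d (gdPhi K m n q g)) h0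
  simp only [hf, map_zero, map_sum] at h1
  have h2 : ∀ e, weightedHomogeneousComponent (gdw' m n q) d
      (gdPhi K m n q (weightedHomogeneousComponent (gdw m n) e f)) =
      if e = d then gdPhi K m n q (weightedHomogeneousComponent (gdw m n) e f) else 0 := by
    intro e
    have := gdPhi_homog q e _ (weightedHomogeneousComponent_isWeightedHomogeneous (w := gdw m n) e f)
    by_cases h : e = d
    · subst h
      rw [if_pos rfl, this.weightedHomogeneousComponent_same]
    · rw [if_neg h, this.weightedHomogeneousComponent_ne _ (Ne.symm h)]
  simp only [h2, Finset.sum_ite_eq'] at h1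
  split_ifs at h1 with h
  · exact h1
  · have h' : weightedHomogeneousComponent (gdw m n) d f = 0 := by
      by_contra hne
      exact h ((Set.Finite.mem_toFinset _).mpr hne)
    rw [h', map_zero]

theorem gd_euler (d : Fin m → ℕ) (f : MvPolynomial (Fin m × Fin n) K)
    (hf : IsWeightedHomogeneous (gdw m n) f d) (r : Fin m) : gdE r r f = d r • f := by
  have h : IsWeightedHomogeneous (fun p : Fin m × Fin n => if p.1 = r then 1 else 0) f (d r) := by
    intro s hs
    have := congrFun (hf hs) r
    rw [Finsupp.weight_apply, Finsupp.sum] at this ⊢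
    rw [← this, Finset.sum_apply]
    apply Finset.sum_congr rfl
    intro p _
    simp [gdw, Pi.single_apply, eq_comm]
  rw [← h.sum_weight_X_mul_pderiv, gdE_apply, Fintype.sum_prod_type, Finset.sum_eq_single r]
  · simp
  · intro b _ hb; simp [hb]
  · simp

theorem gd_E_homog (d : Fin m → ℕ) (f : MvPolynomial (Fin m × Fin n) K)
    (hf : IsWeightedHomogeneous (gdw m n) f d) (k r : Fin m) (hr : 0 < d r) :
    IsWeightedHomogeneous (gdw m n) (gdE k r f) (Pi.single k 1 + (d - Pi.single r 1)) := by
  rw [gdE_apply]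
  apply IsWeightedHomogeneous.sum
  intro c _
  apply IsWeightedHomogeneous.mul
  · exact isWeightedHomogeneous_X K (gdw m n) (k, c)
  · apply hf.pderiv
    ext i
    by_cases h : i = r
    · subst h; simp [gdw]; omega
    · simp [gdw, h]

theorem gd_E_zero (d : Fin m → ℕ) (f : MvPolynomial (Fin m × Fin n) K)
    (hf : IsWeightedHomogeneous (gdw m n) f d) (k r : Fin m) (hr : d r = 0) :
    gdE k r f = 0 := by
  rw [gdE_apply]
  apply Finset.sum_eq_zero
  intro c _
  rw [MvPolynomial.pderiv_eq_zero_of_notMem_vars, mul_zero]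
  intro hv
  rw [MvPolynomial.mem_vars_iff_mem_support] at hv
  obtain ⟨s, hs, hv⟩ := hv
  have := congrFun (hf (MvPolynomial.mem_support_iff.mp hs)) r
  rw [Finsupp.weight_apply, Finsupp.sum, hr, Finset.sum_apply, Finset.sum_eq_zero_iff] at this
  have := this _ hv
  rw [Finsupp.mem_support_iff] at hv
  simp [gdw] at this
  exact hv this

theorem gd_base (q : ℕ) (hq : q ≤ m) (d : Fin m → ℕ) (f : MvPolynomial (Fin m × Fin n) K)
    (hf : IsWeightedHomogeneous (gdw m n) f d) (hd : ∀ r : Fin m, q ≤ r.val → d r = 0)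
    (h : gdPhi K m n q f = 0) : f = 0 := by
  let ψ : MvPolynomial (Fin m × Fin q ⊕ Fin q × Fin n) K →ₐ[K] MvPolynomial (Fin m × Fin n) K :=
    MvPolynomial.aeval (Sum.elim (fun p => if p.1.val = p.2.val then 1 else 0)
      (fun p => MvPolynomial.X (⟨p.1.val, by omega⟩, p.2)))
  have h1 : ψ (gdPhi K m n q f) = f := by
    rw [← AlgHom.comp_apply]
    have : (ψ.comp (gdPhi K m n q)) f = AlgHom.id K _ f := by
      apply MvPolynomial.hom_congr_vars (f₁ := (ψ.comp (gdPhi K m n q)).toRingHom)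
        (f₂ := (AlgHom.id K _).toRingHom) _ _ rfl
      · ext1 c; simp
      · rintro ⟨i, j⟩ hv _
        have hi : i.val < q := by
          by_contra hi
          have hi := hd i (by omega)
          rw [MvPolynomial.mem_vars_iff_mem_support] at hv
          obtain ⟨s, hs, hv⟩ := hv
          have := congrFun (hf (MvPolynomial.mem_support_iff.mp hs)) i
          rw [Finsupp.weight_apply, Finsupp.sum, hi, Finset.sum_apply,
            Finset.sum_eq_zero_iff] at this
          have := this _ hv
          rw [Finsupp.mem_support_iff] at hv
          simp [gdw] at this
          exact hv this
        simp only [AlgHom.toRingHom_eq_coe, RingHom.coe_coe, AlgHom.comp_apply, gdPhi,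
          MvPolynomial.aeval_X, map_sum, map_mul, ψ, Sum.elim_inl, Sum.elim_inr]
        rw [Finset.sum_eq_single ⟨i.val, hi⟩]
        · simp
        · intro k _ hk
          rw [if_neg, zero_mul]
          intro e; exact hk (by ext; exact e.symm)
        · simp
    rw [this]; rfl
  rw [← h1, h, map_zero]

theorem gd_sft_homog [CharZero K] (t : ℕ) (ht : 1 ≤ t) (htm : t ≤ m) (N : ℕ) : ∀ (d : Fin m → ℕ),
    ∑ i, i.val * d i = N → ∀ (f : MvPolynomial (Fin m × Fin n) K),
    IsWeightedHomogeneous (gdw m n) f d → gdPhi K m n (t - 1) f = 0 →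
    f ∈ genericMinors K m n t := by
  induction N using Nat.strong_induction_on with
  | _ N ih =>
    intro d hd f hf h0
    by_cases hall : ∀ r : Fin m, t - 1 ≤ r.val → d r = 0
    · rw [gd_base (t - 1) (by omega) d f hf hall h0]; exact Ideal.zero_mem _
    push Not at hall
    obtain ⟨r, hr, hdr⟩ := hall
    refine gd_hw_mem t ht d f (gd_euler d f hf) ?_ r (by omega) (Nat.pos_of_ne_zero hdr)
    intro k r hkr
    by_cases hz : d r = 0
    · rw [gd_E_zero d f hf k r hz]; exact Ideal.zero_mem _
    refine ih _ ?_ (Pi.single k 1 + (d - Pi.single r 1)) rfl _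
      (gd_E_homog d f hf k r (Nat.pos_of_ne_zero hz)) (by rw [gdPhi_E, h0, map_zero])
    have e : ∑ i, i.val * d i = ∑ i : Fin m, i.val * (d - Pi.single r 1 : Fin m → ℕ) i + r.val := by
      have : d = (d - Pi.single r 1) + Pi.single r 1 := by
        ext i
        by_cases h : i = r
        · subst h; simp; omega
        · simp [h]
      conv_lhs => rw [this]
      simp [mul_add, Finset.sum_add_distrib, Pi.single_apply]
    have e2 : ∑ i : Fin m, i.val * (Pi.single k 1 + (d - Pi.single r 1) : Fin m → ℕ) i =
        ∑ i : Fin m, i.val * (d - Pi.single r 1 : Fin m → ℕ) i + k.val := by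
      simp only [Pi.add_apply, mul_add, Finset.sum_add_distrib]
      rw [add_comm]
      simp [Pi.single_apply]
    rw [e2, ← hd, e]
    have : k.val < r.val := hkr
    omega

theorem gdPhi_ker_le [CharZero K] (t : ℕ) (ht : 1 ≤ t) (htm : t ≤ m) (f : MvPolynomial (Fin m × Fin n) K)
    (h0 : gdPhi K m n (t - 1) f = 0) : f ∈ genericMinors K m n t := by
  have hfin := weightedHomogeneousComponent_finsupp (w := gdw m n) f
  rw [← finsum_weightedHomogeneousComponent (gdw m n) f, finsum_eq_sum _ hfin]
  apply Ideal.sum_mem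
  intro d _
  exact gd_sft_homog t ht htm _ d rfl _ (weightedHomogeneousComponent_isWeightedHomogeneous d f)
    (gdPhi_comp _ _ _ h0)

end GenDet3
section GenDet4

variable {K : Type*} [Field K] {m n : ℕ}

theorem gd_det_mul_zero {R : Type*} [CommRing R] (q : ℕ) (A : Matrix (Fin (q+1)) (Fin q) R)
    (B : Matrix (Fin q) (Fin (q+1)) R) : (A * B).det = 0 := by
  let A' : Matrix (Fin (q+1)) (Fin (q+1)) R := Matrix.of fun i => Fin.snoc (fun k => A i k) 0
  let B' : Matrix (Fin (q+1)) (Fin (q+1)) R := Matrix.of fun k j => 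
    (Fin.snoc (fun k => B k j) 0 : Fin (q+1) → R) k
  have h : A * B = A' * B' := by
    ext i j
    simp [Matrix.mul_apply, A', B', Fin.sum_univ_castSucc]
  rw [h, Matrix.det_mul, Matrix.det_eq_zero_of_column_eq_zero (A := A') (Fin.last q), zero_mul]
  intro i
  simp [A']

theorem gdPhi_minors (t : ℕ) (ht : 1 ≤ t) (f : MvPolynomial (Fin m × Fin n) K)
    (hf : f ∈ genericMinors K m n t) : gdPhi K m n (t - 1) f = 0 := by
  obtain ⟨q, rfl⟩ : ∃ q, t = q + 1 := ⟨t - 1, by omega⟩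
  have : genericMinors K m n (q + 1) ≤ RingHom.ker (gdPhi K m n q) := by
    rw [genericMinors, Ideal.span_le]
    rintro _ ⟨r, c, -, -, rfl⟩
    rw [SetLike.mem_coe, RingHom.mem_ker, AlgHom.map_det]
    convert gd_det_mul_zero q
      (Matrix.of fun i k => (MvPolynomial.X (Sum.inl (r i, k)) :
        MvPolynomial (Fin m × Fin q ⊕ Fin q × Fin n) K))
      (Matrix.of fun k j => MvPolynomial.X (Sum.inr (k, c j))) using 2
    ext1 i j
    simp [gdPhi, Matrix.mul_apply]
  exact this hf

theorem gd_mem_iff [CharZero K] (t : ℕ) (ht : 1 ≤ t) (htm : t ≤ m)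
    (f : MvPolynomial (Fin m × Fin n) K) :
    f ∈ genericMinors K m n t ↔ gdPhi K m n (t - 1) f = 0 :=
  ⟨gdPhi_minors t ht f, gdPhi_ker_le t ht htm f⟩

theorem gd_prime [CharZero K] (t : ℕ) (ht : 1 ≤ t) (htm : t ≤ m) :
    (genericMinors K m n t).IsPrime := by
  have : genericMinors K m n t = RingHom.ker (gdPhi K m n (t - 1)) := by
    ext f; rw [gd_mem_iff t ht htm, RingHom.mem_ker]
  rw [this]
  exact RingHom.ker_isPrime _

theorem gd_mem_symbolic {R : Type*} [CommRing R] [IsNoetherianRing R] (I : Ideal R)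
    (hI : I.IsPrime) (s : ℕ) (f : R) :
    f ∈ symbolicPower I s ↔ ∃ g, g ∉ I ∧ g * f ∈ I ^ s := by
  have key : ∀ (p : Ideal R) (hp : p.IsPrime), (f ∈ Ideal.comap (algebraMap R (Localization.AtPrime p))
      (Ideal.map (algebraMap R (Localization.AtPrime p)) (I ^ s))) ↔ ∃ g, g ∉ p ∧ g * f ∈ I ^ s := by
    intro p hp
    rw [Ideal.mem_comap, IsLocalization.algebraMap_mem_map_algebraMap_iff p.primeCompl]
    rfl
  have hass : associatedPrimes R (R ⧸ I) = {I} := by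
    rw [associatedPrimes.eq_singleton_of_isPrimary hI.isPrimary, hI.radical]
  unfold symbolicPower
  rw [Ideal.mem_iInf]
  constructor
  · intro h
    exact (key I hI).mp (h ⟨I, by rw [hass]; rfl⟩)
  · rintro h ⟨p, hp⟩
    have : p = I := by rw [hass] at hp; exact hp
    subst this
    exact (key p hI).mpr h

/-! ### upper bound -/

theorem gd_minor_ne_zero {ι : Type*} [Fintype ι] [DecidableEq ι] (r : ι → Fin m) (c : ι → Fin n)
    (hr : Function.Injective r) (hc : Function.Injective c) :
    Matrix.det (Matrix.of fun i j =>
      (MvPolynomial.X (r i, c j) : MvPolynomial (Fin m × Fin n) K)) ≠ 0 ∧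
    (Matrix.det (Matrix.of fun i j =>
      (MvPolynomial.X (r i, c j) : MvPolynomial (Fin m × Fin n) K))).IsHomogeneous
        (Fintype.card ι) := by
  constructor
  · have h : Matrix.det (Matrix.of fun i j =>
      (MvPolynomial.X (r i, c j) : MvPolynomial (Fin m × Fin n) K)) =
      MvPolynomial.rename (Prod.map r c) (Matrix.det (Matrix.mvPolynomialX ι ι K)) := by
      rw [AlgHom.map_det]
      congr 1
      ext1 i j
      simp
    rw [h]
    intro h0
    rw [map_eq_zero_iff _ (MvPolynomial.rename_injective _ (hr.prodMap hc))] at h0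
    exact Matrix.det_mvPolynomialX_ne_zero ι K h0
  · rw [Matrix.det_apply]
    apply MvPolynomial.IsHomogeneous.sum
    intro σ _
    have : (∏ i, (Matrix.of fun i j =>
      (MvPolynomial.X (r i, c j) : MvPolynomial (Fin m × Fin n) K)) (σ i) i).IsHomogeneous
        (∑ i : ι, 1) := by
      apply MvPolynomial.IsHomogeneous.prod
      intro i _
      exact MvPolynomial.isHomogeneous_X _ _
    rw [Finset.sum_const, Finset.card_univ, smul_eq_mul, mul_one] at this
    rcases Int.units_eq_one_or (Equiv.Perm.sign σ) with h | h <;> rw [h]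
    · simpa using this
    · simpa using this.neg

theorem gd_small_minor_not_mem (q : ℕ) (r : Fin q → Fin m) (c : Fin q → Fin n)
    (hr : Function.Injective r) (hc : Function.Injective c) :
    gdPhi K m n q (Matrix.det (Matrix.of fun i j =>
      (MvPolynomial.X (r i, c j) : MvPolynomial (Fin m × Fin n) K))) ≠ 0 := by
  intro h
  classical
  let ev : MvPolynomial (Fin m × Fin q ⊕ Fin q × Fin n) K →ₐ[K] K :=
    MvPolynomial.aeval (Sum.elim (fun p => if p.1 = r p.2 then 1 else 0)
      (fun p => if p.2 = c p.1 then 1 else 0))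
  have h1 := congrArg ev h
  rw [map_zero, AlgHom.map_det, AlgHom.map_det] at h1
  have : ev.mapMatrix ((gdPhi K m n q).mapMatrix (Matrix.of fun i j =>
      (MvPolynomial.X (r i, c j) : MvPolynomial (Fin m × Fin n) K))) = 1 := by
    ext i j
    simp [gdPhi, ev, Matrix.one_apply, hr.eq_iff, hc.eq_iff, eq_comm]
  rw [this, Matrix.det_one] at h1
  exact one_ne_zero h1

theorem gd_block {R : Type*} [CommRing R] {α β : Type*} [Fintype α] [DecidableEq α]
    [Fintype β] [DecidableEq β] (A : Matrix α α R) (B : Matrix α β R) (C : Matrix β α R)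
    (D : Matrix β β R) :
    A.det ^ (Fintype.card β) * (Matrix.fromBlocks A B C D).det =
      A.det * (A.det • D - C * A.adjugate * B).det := by
  have h : Matrix.fromBlocks A B C D * Matrix.fromBlocks 1 (-(A.adjugate * B)) 0 (A.det • (1 : Matrix β β R))
      = Matrix.fromBlocks A 0 C (A.det • D - C * A.adjugate * B) := by
    rw [Matrix.fromBlocks_multiply]
    congr 1
    · simp
    · rw [Matrix.mul_neg, ← Matrix.mul_assoc, Matrix.mul_adjugate]; simp
    · simp
    · rw [Matrix.mul_neg, ← Matrix.mul_assoc]; simp [sub_eq_add_neg, add_comm]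
  have h2 := congrArg Matrix.det h
  rw [Matrix.det_mul, Matrix.det_fromBlocks_zero₂₁, Matrix.det_fromBlocks_zero₁₂, Matrix.det_one,
    Matrix.det_smul, Matrix.det_one] at h2
  rw [← h2]; ring

theorem gd_det_mem_pow {R : Type*} [CommRing R] (I : Ideal R) {β : Type*} [Fintype β]
    [DecidableEq β] (M : Matrix β β R) (h : ∀ i j, M i j ∈ I) : M.det ∈ I ^ (Fintype.card β) := by
  rw [Matrix.det_apply]
  apply Ideal.sum_mem
  intro σ _
  have : ∏ i, M (σ i) i ∈ I ^ (Fintype.card β) := by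
    have := Ideal.prod_mem_prod (s := Finset.univ) (I := fun _ : β => I) (x := fun i => M (σ i) i)
      (fun i _ => h _ _)
    simpa using this
  rcases Int.units_eq_one_or (Equiv.Perm.sign σ) with h | h <;> rw [h]
  · simpa using this
  · simpa using this

theorem gd_minor_symbolic [CharZero K] (q c : ℕ) (htm : q + 1 ≤ m)
    (ρ : Fin q ⊕ Fin c → Fin m) (κ : Fin q ⊕ Fin c → Fin n)
    (hρ : Function.Injective ρ) (hκ : Function.Injective κ) :
    Matrix.det (Matrix.of fun i j =>
      (MvPolynomial.X (ρ i, κ j) : MvPolynomial (Fin m × Fin n) K)) ∈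
      symbolicPower (genericMinors K m n (q + 1)) c := by
  have hP := gd_prime (K := K) (m := m) (n := n) (q + 1) (by omega) htm
  rw [gd_mem_symbolic _ hP]
  let M : Matrix (Fin q ⊕ Fin c) (Fin q ⊕ Fin c) (MvPolynomial (Fin m × Fin n) K) :=
    Matrix.of fun i j => MvPolynomial.X (ρ i, κ j)
  change ∃ g, g ∉ _ ∧ g * M.det ∈ _
  have hδ : M.toBlocks₁₁.det ∉ genericMinors K m n (q + 1) := by
    intro h
    have hM : M.toBlocks₁₁ = Matrix.of fun i j => (MvPolynomial.X
      ((fun i => ρ (Sum.inl i)) i, (fun i => κ (Sum.inl i)) j) : MvPolynomial (Fin m × Fin n) K) := by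
      ext1 i j
      simp only [M, Matrix.toBlocks₁₁, Matrix.of_apply]
    have h2 := (gd_mem_iff (K := K) (q + 1) (by omega) htm _).1 h
    rw [Nat.add_sub_cancel, hM] at h2
    exact gd_small_minor_not_mem (K := K) q (fun i => ρ (Sum.inl i)) (fun i => κ (Sum.inl i))
      (hρ.comp Sum.inl_injective) (hκ.comp Sum.inl_injective) h2
  refine ⟨M.toBlocks₁₁.det ^ c, fun h => hδ (hP.mem_of_pow_mem _ h), ?_⟩
  have hb := gd_block M.toBlocks₁₁ M.toBlocks₁₂ M.toBlocks₂₁ M.toBlocks₂₂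
  rw [Matrix.fromBlocks_toBlocks, Fintype.card_fin] at hb
  rw [hb]
  apply Ideal.mul_mem_left
  have := gd_det_mem_pow (genericMinors K m n (q + 1)) (M.toBlocks₁₁.det • M.toBlocks₂₂ -
    M.toBlocks₂₁ * M.toBlocks₁₁.adjugate * M.toBlocks₁₂) ?_
  · simpa using this
  intro i j
  have hb1 := gd_block M.toBlocks₁₁ (Matrix.of fun a (_ : Fin 1) => M (Sum.inl a) (Sum.inr j))
    (Matrix.of fun (_ : Fin 1) a => M (Sum.inr i) (Sum.inl a))
    (Matrix.of fun (_ : Fin 1) (_ : Fin 1) => M (Sum.inr i) (Sum.inr j))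
  have hmem : (Matrix.fromBlocks M.toBlocks₁₁
    (Matrix.of fun a (_ : Fin 1) => M (Sum.inl a) (Sum.inr j))
    (Matrix.of fun (_ : Fin 1) a => M (Sum.inr i) (Sum.inl a))
    (Matrix.of fun (_ : Fin 1) (_ : Fin 1) => M (Sum.inr i) (Sum.inr j))).det
      ∈ genericMinors K m n (q + 1) := by
    have := gd_minor_mem (K := K) (q + 1)
      (fun a => ρ ((Sum.elim Sum.inl (fun _ => Sum.inr i) : Fin q ⊕ Fin 1 → _) (finSumFinEquiv.symm a)))
      (fun a => κ ((Sum.elim Sum.inl (fun _ => Sum.inr j) : Fin q ⊕ Fin 1 → _) (finSumFinEquiv.symm a)))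
    rw [← Matrix.det_submatrix_equiv_self finSumFinEquiv] at this
    convert this using 2
    ext1 a b
    rcases a with a | a <;> rcases b with b | b <;> simp [M, Matrix.toBlocks₁₁]
  have h3 := Ideal.mul_mem_left _ (M.toBlocks₁₁.det ^ (Fintype.card (Fin 1))) hmem
  rw [hb1] at h3
  have h4 := (hP.mem_or_mem h3).resolve_left hδ
  rw [Matrix.det_fin_one] at h4
  convert h4 using 1
  simp only [Matrix.sub_apply, Matrix.smul_apply, Matrix.mul_apply, Matrix.of_apply,
    Matrix.toBlocks₂₂, Matrix.toBlocks₂₁, Matrix.toBlocks₁₂]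

theorem gd_symbolic_mul [CharZero K] (t : ℕ) (ht : 1 ≤ t) (htm : t ≤ m) (a b : ℕ)
    (f g : MvPolynomial (Fin m × Fin n) K) (hf : f ∈ symbolicPower (genericMinors K m n t) a)
    (hg : g ∈ symbolicPower (genericMinors K m n t) b) :
    f * g ∈ symbolicPower (genericMinors K m n t) (a + b) := by
  have hP := gd_prime (K := K) (m := m) (n := n) t ht htm
  rw [gd_mem_symbolic _ hP] at *
  obtain ⟨u, hu, hu'⟩ := hf
  obtain ⟨v, hv, hv'⟩ := hg
  refine ⟨u * v, fun h => (hP.mem_or_mem h).elim hu hv, ?_⟩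
  rw [pow_add]
  convert Ideal.mul_mem_mul hu' hv' using 1
  ring

theorem gd_exists_minor [CharZero K] (t : ℕ) (hmn : m ≤ n) (ht : 1 ≤ t) (htm : t ≤ m) (l : ℕ)
    (hl : l ≤ m - t) : ∃ f ∈ symbolicPower (genericMinors K m n t) (m - t + 1 - l),
      f ≠ 0 ∧ f.IsHomogeneous (m - l) := by
  obtain ⟨q, rfl⟩ : ∃ q, t = q + 1 := ⟨t - 1, by omega⟩
  let e : Fin q ⊕ Fin (m - (q + 1) + 1 - l) → Fin m :=
    fun a => ⟨(finSumFinEquiv a).val, by have := (finSumFinEquiv a).isLt; omega⟩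
  let e' : Fin q ⊕ Fin (m - (q + 1) + 1 - l) → Fin n :=
    fun a => ⟨(finSumFinEquiv a).val, by have := (finSumFinEquiv a).isLt; omega⟩
  have he : Function.Injective e := by
    intro a b h
    simp only [e, Fin.mk.injEq] at h
    exact finSumFinEquiv.injective (Fin.ext h)
  have he' : Function.Injective e' := by
    intro a b h
    simp only [e', Fin.mk.injEq] at h
    exact finSumFinEquiv.injective (Fin.ext h)
  have h := gd_minor_ne_zero (K := K) e e' he he'
  refine ⟨_, gd_minor_symbolic q _ htm e e' he he', h.1, ?_⟩
  have h2 := h.2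
  have hc : Fintype.card (Fin q ⊕ Fin (m - (q + 1) + 1 - l)) = m - l := by
    simp; omega
  rw [hc] at h2
  exact h2

theorem gd_upper [CharZero K] (t : ℕ) (hmn : m ≤ n) (ht : 1 ≤ t) (htm : t ≤ m) (l : ℕ)
    (hl : l ≤ m - t) (k : ℕ) :
    ∃ f ∈ symbolicPower (genericMinors K m n t) ((k + 1) * (m - t + 1) - l),
      f ≠ 0 ∧ f.IsHomogeneous ((k + 1) * m - l) := by
  induction k with
  | zero => simpa using gd_exists_minor (K := K) t hmn ht htm l hl
  | succ k ih =>
    obtain ⟨f, hf, hf0, hfh⟩ := ih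
    obtain ⟨g, hg, hg0, hgh⟩ := gd_exists_minor (K := K) t hmn ht htm 0 (by omega)
    refine ⟨f * g, ?_, mul_ne_zero hf0 hg0, ?_⟩
    · have := gd_symbolic_mul t ht htm _ _ _ _ hf hg
      convert this using 2
      have : (k + 1 + 1) * (m - t + 1) = (k + 1) * (m - t + 1) + (m - t + 1) := by ring
      have h2 : l ≤ (k + 1) * (m - t + 1) := by nlinarith
      omega
    · have := hfh.mul hgh
      convert this using 1
      have h1 : (k + 1 + 1) * m = (k + 1) * m + m := by ring
      have h2 : m ≤ (k + 1) * m := by nlinarith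
      omega

end GenDet4
section GenDet5

theorem gd_comb (m q c k l s : ℕ) (a : Fin m → ℕ) (hm : q + c = m) (hl : l < c) (hk : 1 ≤ k)
    (hs : s = k * c - l)
    (h : ∀ T : Finset (Fin m), T.card = q → s ≤ ∑ i, a i * (if i ∈ T then 0 else 1)) :
    k * m - l ≤ ∑ i, a i := by
  have key : ∀ T : Finset (Fin m), ∑ i, a i * (if i ∈ T then 0 else 1) = ∑ i ∈ Tᶜ, a i := by
    intro T
    rw [← Finset.sum_subset (Finset.subset_univ Tᶜ)]
    · refine Finset.sum_congr rfl fun i hi => ?_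
      rw [Finset.mem_compl] at hi
      simp [hi]
    · intro i _ hi
      rw [Finset.mem_compl, not_not] at hi
      simp [hi]
  have hkc : c ≤ k * c := by nlinarith
  obtain ⟨k', rfl⟩ : ∃ k', k = k' + 1 := ⟨k - 1, by omega⟩
  rcases le_total q (Finset.univ.filter fun i => k' + 1 ≤ a i).card with hc | hc
  · obtain ⟨T, hT, hTc⟩ := Finset.exists_subset_card_eq hc
    have h1 := h T hTc
    rw [key] at h1
    rw [← Finset.sum_add_sum_compl T]
    have h2 : T.card • (k' + 1) ≤ ∑ i ∈ T, a i :=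
      Finset.card_nsmul_le_sum _ _ _ fun i hi => (Finset.mem_filter.1 (hT hi)).2
    rw [hTc, smul_eq_mul] at h2
    have : (k' + 1) * m = q * (k' + 1) + (k' + 1) * c := by rw [← hm]; ring
    omega
  · obtain ⟨T, hT, hTc⟩ := Finset.exists_superset_card_eq hc (by simp; omega)
    have h1 := h T hTc
    rw [key] at h1
    have h2 : ∑ i ∈ Tᶜ, a i ≤ Tᶜ.card • k' := by
      apply Finset.sum_le_card_nsmul
      intro i hi
      by_contra hcon
      exact (Finset.mem_compl.1 hi) (hT (Finset.mem_filter.2 ⟨Finset.mem_univ _, by omega⟩))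
    rw [Finset.card_compl, hTc, smul_eq_mul, Fintype.card_fin,
      show m - q = c by omega] at h2
    have : (k' + 1) * c = c * k' + c := by ring
    omega

variable {K : Type*} [Field K] {m n : ℕ}

/-- coefficient ring -/
abbrev GdL (K : Type*) [Field K] (m n : ℕ) := MvPolynomial (Fin m × Fin m ⊕ Fin m × Fin n) K

/-- product parametrization entry coefficient -/
noncomputable def gdYZ (K : Type*) [Field K] (m n : ℕ) (i : Fin m) (k : Fin m) (j : Fin n) :
    GdL K m n := X (Sum.inl (i, k)) * X (Sum.inr (k, j))

noncomputable def gdTheta (K : Type*) [Field K] (m n : ℕ) :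
    MvPolynomial (Fin m × Fin n) K →ₐ[K] MvPolynomial (Fin m) (GdL K m n) :=
  aeval fun p => ∑ k, C (gdYZ K m n p.1 k p.2) * X k

noncomputable def gdPsi (K : Type*) [Field K] (m n : ℕ) (T : Finset (Fin m)) :
    MvPolynomial (Fin m) (GdL K m n) →ₐ[K] Polynomial (MvPolynomial (Fin m) (GdL K m n)) :=
  AlgHom.restrictScalars K (aeval (R := GdL K m n)
    fun k => Polynomial.C (X k) * Polynomial.X ^ (if k ∈ T then 0 else 1))

noncomputable def gdTheta0 (K : Type*) [Field K] (m n q : ℕ) (e : Fin q → Fin m) :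
    MvPolynomial (Fin m × Fin n) K →ₐ[K] MvPolynomial (Fin m) (GdL K m n) :=
  aeval fun p => ∑ a, C (gdYZ K m n p.1 (e a) p.2) * X (e a)

theorem gdTheta_inj (f : MvPolynomial (Fin m × Fin n) K) (h : gdTheta K m n f = 0) : f = 0 := by
  classical
  let ev1 : GdL K m n →ₐ[K] MvPolynomial (Fin m × Fin n) K :=
    aeval (Sum.elim (fun p => if p.1 = p.2 then 1 else 0) (fun p => X p))
  let ev : MvPolynomial (Fin m) (GdL K m n) →+* MvPolynomial (Fin m × Fin n) K :=
    eval₂Hom ev1.toRingHom (fun _ => 1)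
  have : ev.comp (gdTheta K m n).toRingHom = RingHom.id _ := by
    apply MvPolynomial.ringHom_ext
    · intro r
      simp only [AlgHom.toRingHom_eq_coe, RingHom.coe_comp, RingHom.coe_coe, Function.comp_apply,
        RingHom.id_apply]
      rw [← algebraMap_eq, AlgHom.commutes, IsScalarTower.algebraMap_apply K (GdL K m n)]
      simp [ev, ev1, algebraMap_eq]
    · rintro ⟨i, j⟩
      simp [ev, ev1, gdTheta, gdYZ]
  have h2 := congrArg (fun φ => φ f) this
  simp only [RingHom.coe_comp, Function.comp_apply, RingHom.id_apply] at h2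
  rw [← h2]
  change ev (gdTheta K m n f) = 0
  rw [h, map_zero]

theorem gdTheta_homog (f : MvPolynomial (Fin m × Fin n) K) (d : ℕ) (h : f.IsHomogeneous d) :
    (gdTheta K m n f).IsHomogeneous d := by
  have := h.aeval (n := 1) (fun p : Fin m × Fin n => ∑ k, C (gdYZ K m n p.1 k p.2) * X k) ?_
  · rw [one_mul] at this
    exact this
  · intro p
    apply IsHomogeneous.sum
    intro k _
    simpa using (isHomogeneous_C (Fin m) (gdYZ K m n p.1 k p.2)).mul (isHomogeneous_X _ k)

theorem gdTheta0_ev (q : ℕ) (e : Fin q → Fin m) (he : Function.Injective e) (T : Finset (Fin m))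
    (hT : Finset.univ.image e = T) (f : MvPolynomial (Fin m × Fin n) K) :
    (gdPsi K m n T (gdTheta K m n f)).coeff 0 = gdTheta0 K m n q e f := by
  rw [Polynomial.coeff_zero_eq_eval_zero]
  let E : Polynomial (MvPolynomial (Fin m) (GdL K m n)) →ₐ[K] MvPolynomial (Fin m) (GdL K m n) :=
    AlgHom.restrictScalars K (Polynomial.aeval (0 : MvPolynomial (Fin m) (GdL K m n)))
  have : (E.comp ((gdPsi K m n T).comp (gdTheta K m n))) = gdTheta0 K m n q e := by
    apply MvPolynomial.algHom_ext
    rintro ⟨i, j⟩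
    simp only [E, AlgHom.comp_apply, gdTheta, gdTheta0, gdPsi, aeval_X, map_sum, map_mul,
      AlgHom.restrictScalars_apply, map_pow, Polynomial.aeval_X, Polynomial.aeval_C]
    rw [← Finset.sum_subset (Finset.subset_univ T), ← hT, Finset.sum_image (fun a _ b _ h => he h)]
    · refine Finset.sum_congr rfl fun a _ => ?_
      simp [MvPolynomial.aeval_C, Polynomial.algebraMap_apply, algebraMap_eq]
    · intro k _ hk
      simp [hk]
  rw [← this]
  simp [E, Polynomial.coe_aeval_eq_eval]

theorem gdTheta0_zero_iff (q : ℕ) (e : Fin q → Fin m) (he : Function.Injective e)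
    (f : MvPolynomial (Fin m × Fin n) K) :
    gdTheta0 K m n q e f = 0 ↔ gdPhi K m n q f = 0 := by
  classical
  constructor
  · intro h
    let ev1 : GdL K m n →ₐ[K] MvPolynomial (Fin m × Fin q ⊕ Fin q × Fin n) K :=
      aeval (Sum.elim (fun p => ∑ a, if e a = p.2 then X (Sum.inl (p.1, a)) else 0)
        (fun p => ∑ a, if e a = p.1 then X (Sum.inr (a, p.2)) else 0))
    let ev : MvPolynomial (Fin m) (GdL K m n) →+* MvPolynomial (Fin m × Fin q ⊕ Fin q × Fin n) K :=
      eval₂Hom ev1.toRingHom (fun _ => 1)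
    have : ev.comp (gdTheta0 K m n q e).toRingHom = (gdPhi K m n q).toRingHom := by
      apply MvPolynomial.ringHom_ext
      · intro r
        simp only [AlgHom.toRingHom_eq_coe, RingHom.coe_comp, RingHom.coe_coe, Function.comp_apply]
        rw [← algebraMap_eq, AlgHom.commutes, AlgHom.commutes,
          IsScalarTower.algebraMap_apply K (GdL K m n)]
        simp [ev, ev1, algebraMap_eq]
      · rintro ⟨i, j⟩
        simp [ev, ev1, gdTheta0, gdYZ, gdPhi, he.eq_iff]
    have h2 := congrArg (fun φ => φ f) this
    simp only [RingHom.coe_comp, Function.comp_apply] at h2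
    change ev (gdTheta0 K m n q e f) = gdPhi K m n q f at h2
    rw [← h2, h, map_zero]
  · intro h
    let χ : MvPolynomial (Fin m × Fin q ⊕ Fin q × Fin n) K →ₐ[K] MvPolynomial (Fin m) (GdL K m n) :=
      aeval (Sum.elim (fun p => C (X (Sum.inl (p.1, e p.2))))
        (fun p => C (X (Sum.inr (e p.1, p.2))) * X (e p.1)))
    have : χ.comp (gdPhi K m n q) = gdTheta0 K m n q e := by
      apply MvPolynomial.algHom_ext
      rintro ⟨i, j⟩
      simp [χ, gdTheta0, gdPhi, gdYZ, mul_assoc]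
    rw [← this, AlgHom.comp_apply, h, map_zero]

theorem gdPsi_coeff (T : Finset (Fin m)) (h : MvPolynomial (Fin m) (GdL K m n)) (a : Fin m →₀ ℕ) :
    coeff a ((gdPsi K m n T h).coeff (∑ i, a i * (if i ∈ T then 0 else 1))) = coeff a h := by
  classical
  induction h using MvPolynomial.induction_on' with
  | monomial b r =>
    have : gdPsi K m n T (monomial b r) = Polynomial.C (monomial b r) *
        Polynomial.X ^ (∑ i, b i * (if i ∈ T then 0 else 1)) := by
      rw [gdPsi, AlgHom.restrictScalars_apply, aeval_monomial, Finsupp.prod_fintype _ _ (by simp),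
        monomial_eq, Finsupp.prod_fintype _ _ (by simp)]
      simp only [mul_pow, Finset.prod_mul_distrib, ← pow_mul, Finset.prod_pow_eq_pow_sum, map_mul,
        map_prod, map_pow]
      rw [IsScalarTower.algebraMap_apply (GdL K m n) (MvPolynomial (Fin m) (GdL K m n)),
        Polynomial.algebraMap_apply, algebraMap_eq]
      simp [mul_comm, mul_left_comm, mul_assoc]
    rw [this, Polynomial.coeff_C_mul, Polynomial.coeff_X_pow, coeff_monomial]
    by_cases hab : b = a
    · subst hab; simp
    · rw [if_neg hab]
      split_ifs
      · rw [mul_one, coeff_monomial, if_neg hab]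
      · simp
  | add p q hp hq => rw [map_add, Polynomial.coeff_add, coeff_add, coeff_add, hp, hq]

theorem gd_lower [CharZero K] (t : ℕ) (ht : 1 ≤ t) (htm : t ≤ m) (k l d : ℕ) (hk : 1 ≤ k)
    (hl : l ≤ m - t) (f : MvPolynomial (Fin m × Fin n) K)
    (hf : f ∈ symbolicPower (genericMinors K m n t) (k * (m - t + 1) - l)) (hf0 : f ≠ 0)
    (hd : f.IsHomogeneous d) : k * m - l ≤ d := by
  have hP := gd_prime (K := K) (m := m) (n := n) t ht htm
  rw [gd_mem_symbolic _ hP] at hf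
  obtain ⟨g, hg, hgf⟩ := hf
  have hΘ : gdTheta K m n f ≠ 0 := fun h => hf0 (gdTheta_inj f h)
  obtain ⟨a, ha⟩ := MvPolynomial.ne_zero_iff.1 hΘ
  have had := gdTheta_homog f d hd ha
  rw [← had, Finsupp.weight_apply, Finsupp.sum_fintype _ _ (by simp)]
  simp only [Pi.one_apply, smul_eq_mul, mul_one]
  refine gd_comb m (t - 1) (m - t + 1) k l _ a (by omega) (by omega) hk rfl ?_
  intro T hT
  let e := T.orderEmbOfFin hT
  have he : Finset.univ.image e = T := by
    ext x; rw [← Finset.mem_coe, ← Finset.mem_coe, Finset.coe_image]; simp [e]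
  have hker : ∀ u, u ∈ genericMinors K m n t ↔
      Polynomial.X ∣ gdPsi K m n T (gdTheta K m n u) := by
    intro u
    rw [gd_mem_iff t ht htm, Polynomial.X_dvd_iff, gdTheta0_ev _ e e.injective T he,
      gdTheta0_zero_iff _ e e.injective]
  have hpow : ∀ u ∈ genericMinors K m n t ^ (k * (m - t + 1) - l),
      Polynomial.X ^ (k * (m - t + 1) - l) ∣ gdPsi K m n T (gdTheta K m n u) := by
    intro u hu
    let φ := ((gdPsi K m n T).comp (gdTheta K m n)).toRingHom
    have h1 : (genericMinors K m n t).map φ ≤ Ideal.span {Polynomial.X} := by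
      rw [Ideal.map_le_iff_le_comap]
      intro v hv
      exact Ideal.mem_span_singleton.2 ((hker v).1 hv)
    have h2 := Ideal.pow_right_mono h1 (k * (m - t + 1) - l)
    rw [← Ideal.map_pow, Ideal.span_singleton_pow] at h2
    exact Ideal.mem_span_singleton.1 (h2 (Ideal.mem_map_of_mem φ hu))
  have h1 := hpow _ hgf
  rw [map_mul, map_mul] at h1
  have h2 := Polynomial.prime_X.pow_dvd_of_dvd_mul_left _ (fun h => hg ((hker g).2 h)) h1
  by_contra hlt
  rw [not_le] at hlt
  have h3 := Polynomial.X_pow_dvd_iff.1 h2 _ hlt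
  apply ha
  rw [← gdPsi_coeff T, h3, coeff_zero]

theorem gd_alpha [CharZero K] (t : ℕ) (hmn : m ≤ n) (ht : 1 ≤ t) (htm : t ≤ m) (k l : ℕ)
    (hk : 1 ≤ k) (hl : l ≤ m - t) :
    alphaDeg (symbolicPower (genericMinors K m n t) (k * (m - t + 1) - l)) = k * m - l := by
  obtain ⟨k', rfl⟩ : ∃ k', k = k' + 1 := ⟨k - 1, by omega⟩
  have hu := gd_upper (K := K) (n := n) t hmn ht htm l hl k'
  apply le_antisymm
  · exact Nat.sInf_le hu
  · refine le_csInf ⟨_, hu⟩ ?_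
    rintro d ⟨f, hf, hf0, hd⟩
    exact gd_lower t ht htm _ l d hk hl f hf hf0 hd

theorem gd_limit (m t : ℕ) (ht : 1 ≤ t) (htm : t ≤ m) (F : ℕ → ℕ)
    (h : ∀ k l : ℕ, 1 ≤ k → l ≤ m - t → F (k * (m - t + 1) - l) = k * m - l) :
    Tendsto (fun s : ℕ => (F s : ℝ) / s) atTop (nhds ((m : ℝ) / ((m : ℝ) - t + 1))) := by
  obtain ⟨p, rfl⟩ : ∃ p, m = t + p := ⟨m - t, by omega⟩
  simp only [Nat.add_sub_cancel_left] at h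
  have hc : ((t + p : ℕ) : ℝ) - t + 1 = (p : ℝ) + 1 := by push_cast; ring
  rw [hc]
  have hp : (0 : ℝ) < (p : ℝ) + 1 := by positivity
  have hT : (1 : ℝ) ≤ t := by exact_mod_cast ht
  rw [tendsto_iff_dist_tendsto_zero]
  refine squeeze_zero' (g := fun s : ℕ => ((t + p : ℕ) : ℝ) / s) (Eventually.of_forall fun _ => dist_nonneg) ?_
    (tendsto_const_div_atTop_nhds_zero_nat _)
  filter_upwards [eventually_ge_atTop 1] with s hs
  obtain ⟨k, l, hk, hl, hkl⟩ : ∃ k l : ℕ, 1 ≤ k ∧ l ≤ p ∧ s + l = k * (p + 1) := by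
    refine ⟨(s - 1) / (p + 1) + 1, p - (s - 1) % (p + 1), Nat.le_add_left _ _, Nat.sub_le _ _, ?_⟩
    have h1 := Nat.div_add_mod (s - 1) (p + 1)
    have h2 := Nat.mod_lt (s - 1) (Nat.succ_pos p)
    rw [add_mul, mul_comm ((s - 1) / (p + 1))]
    simp only [Nat.succ_eq_add_one] at h2
    omega
  have hF := h k l hk hl
  rw [← hkl, Nat.add_sub_cancel] at hF
  have hle : l ≤ k * (t + p) := by nlinarith
  have hFr : (F s : ℝ) = k * (t + p) - l := by
    rw [hF, Nat.cast_sub hle]; push_cast; ring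
  have hklr : (s : ℝ) + l = k * (p + 1) := by exact_mod_cast hkl
  have hsr : (0 : ℝ) < s := by exact_mod_cast hs
  have hlr : (l : ℝ) ≤ p := by exact_mod_cast hl
  have hl0 : (0 : ℝ) ≤ l := by positivity
  have e1 : (F s : ℝ) / s - ((t + p : ℕ) : ℝ) / (p + 1) = (l * (t - 1) / (p + 1)) / s := by
    rw [hFr]
    have hsE : (s : ℝ) = k * (p + 1) - l := by linarith
    have hne : (k : ℝ) * (p + 1) - l ≠ 0 := by rw [← hsE]; exact hsr.ne'
    rw [hsE]
    push_cast
    field_simp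
    ring
  rw [Real.dist_eq, e1, abs_of_nonneg (by apply div_nonneg _ hsr.le; apply div_nonneg _ hp.le; nlinarith)]
  gcongr
  rw [div_le_iff₀ hp]
  push_cast
  have hp0 : (0 : ℝ) ≤ p := by positivity
  nlinarith [mul_le_mul hlr (le_refl ((t : ℝ) - 1)) (by linarith) hp0]

end GenDet5
/-- Theorem 4.1(1): for the generic determinantal ideal `I_t(X)` with `m ≤ n`,
`α(I_t(X)^{(k(m-t+1)-l)}) = km - l` for `k ≥ 1` and `0 ≤ l ≤ m - t`, and the Waldschmidt
constant of `I_t(X)` equals `m/(m-t+1)`. -/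
theorem generic_determinantal_alpha_waldschmidt {K : Type*} [Field K] [CharZero K]
    (m n t : ℕ) (hmn : m ≤ n) (ht1 : 1 ≤ t) (htm : t ≤ m) :
    (∀ k l : ℕ, 1 ≤ k → l ≤ m - t →
      alphaDeg (symbolicPower (genericMinors K m n t) (k * (m - t + 1) - l)) = k * m - l) ∧
    Tendsto (fun s : ℕ => (alphaDeg (symbolicPower (genericMinors K m n t) s) : ℝ) / s)
      atTop (nhds ((m : ℝ) / ((m : ℝ) - t + 1))) := by
  exact ⟨fun k l hk hl => gd_alpha t hmn ht1 htm k l hk hl,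
    gd_limit m t ht1 htm _ (fun k l hk hl => gd_alpha t hmn ht1 htm k l hk hl)⟩
end

section
/- Let k be a field of characteristic zero, X = (x_{ij}) an m×n matrix of independent indeterminates with m ≤ n, R = k[x_{ij}], and I_t(X) the ideal generated by all t×t minors of X, with 1 < t < m. Then for every positive integer N the following are equivalent: (a) for all s, r ≥ 1, α(I_t(X)^{(s)})/s ≥ (α(I_t(X)^{(r)}) + N − 1)/(r + N − 1) (the Demailly-type bound); (b) for all s ≥ 1, α(I_t(X)^{(s)})/s ≥ (α(I_t(X)) + N − 1)/N (the Chudnovsky-type bound); (c) N ≥ m − t + 1. -/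
open MvPolynomial

namespace GDet

open Finset

/-- The exponent attached to a tuple of variables. -/
noncomputable def expo {σ : Type*} {d : ℕ} (p : Fin d → σ) : σ →₀ ℕ :=
  ∑ a, Finsupp.single (p a) 1

lemma exists_expo {σ : Type*} (e : σ →₀ ℕ) : ∃ (d : ℕ) (p : Fin d → σ), e = expo p := by
  induction e using Finsupp.induction_linear with
  | zero => exact ⟨0, Fin.elim0, by simp [expo]⟩
  | add f g hf hg =>
    obtain ⟨d, p, rfl⟩ := hf
    obtain ⟨d', p', rfl⟩ := hg
    exact ⟨d + d', Fin.append p p', by simp [expo, Fin.sum_univ_add]⟩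
  | single a n => exact ⟨n, fun _ => a, by simp [expo]⟩

lemma expo_apply {σ : Type*} [DecidableEq σ] {d : ℕ} (p : Fin d → σ) (x : σ) :
    expo p x = Fintype.card {a // p a = x} := by
  simp [expo, Finsupp.finsetSum_apply, Finsupp.single_apply, Fintype.card_subtype]

lemma expo_ne_zero {σ : Type*} {d : ℕ} (p : Fin d → σ) (a : Fin d) :
    expo p (p a) ≠ 0 := by
  classical
  rw [expo_apply]
  have : Nonempty {b // p b = p a} := ⟨⟨a, rfl⟩⟩
  exact Fintype.card_ne_zero

/-- weight of an exponent -/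
noncomputable def wt {m n : ℕ} (e : (Fin m × Fin n) →₀ ℕ) : ℕ :=
  e.sum fun x k => k * ((x.1 : ℕ) * (x.2 : ℕ))

lemma wt_add {m n : ℕ} (e f : (Fin m × Fin n) →₀ ℕ) : wt (e + f) = wt e + wt f := by
  classical
  unfold wt
  exact Finsupp.sum_add_index' (by simp) (by intros; ring)

lemma wt_expo {m n d : ℕ} (p : Fin d → Fin m × Fin n) :
    wt (expo p) = ∑ a, ((p a).1 : ℕ) * ((p a).2 : ℕ) := by
  classical
  let W : ((Fin m × Fin n) →₀ ℕ) →+ ℕ :=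
    { toFun := wt, map_zero' := by simp [wt], map_add' := wt_add }
  change W (expo p) = _
  rw [expo, map_sum]
  refine Finset.sum_congr rfl fun a _ => ?_
  change wt _ = _
  simp [wt]

/-- content of a coloured tuple -/
noncomputable def cont {m r n d : ℕ} (p : Fin d → Fin m × Fin n) (c : Fin d → Fin r) :
    ((Fin m × Fin r) ⊕ (Fin r × Fin n)) →₀ ℕ :=
  ∑ a, (Finsupp.single (Sum.inl ((p a).1, c a)) 1 + Finsupp.single (Sum.inr (c a, (p a).2)) 1)

lemma cont_inl {m r n d : ℕ} (p : Fin d → Fin m × Fin n) (c : Fin d → Fin r) (x) :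
    cont p c (Sum.inl x) = Fintype.card {a // ((p a).1, c a) = x} := by
  simp [cont, Finsupp.finsetSum_apply, Finsupp.single_apply, Fintype.card_subtype]

lemma cont_inr {m r n d : ℕ} (p : Fin d → Fin m × Fin n) (c : Fin d → Fin r) (x) :
    cont p c (Sum.inr x) = Fintype.card {a // (c a, (p a).2) = x} := by
  simp [cont, Finsupp.finsetSum_apply, Finsupp.single_apply, Fintype.card_subtype]

lemma sort_lemma {d : ℕ} (f g : Fin d → ℕ) (ρ : Equiv.Perm (Fin d)) (h1 : Monovary f g)
    (h2 : Monovary f (g ∘ ρ)) :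
    ∃ s t : Equiv.Perm (Fin d), f ∘ s = f ∘ t ∧ g ∘ s = g ∘ ρ ∘ t := by
  have key : ∀ g : Fin d → ℕ, Monovary f g →
      ∃ s : Equiv.Perm (Fin d), Monotone (f ∘ s) ∧ Monotone (g ∘ s) := by
    intro g hg
    let F : Fin d → ℕ ×ₗ ℕ := fun a => toLex (f a, g a)
    refine ⟨Tuple.sort F, ?_, ?_⟩
    · intro a b hab
      have := Tuple.monotone_sort F hab
      simp only [Function.comp, F, Prod.Lex.le_iff, ofLex_toLex] at this ⊢
      rcases this with h | h
      · exact h.le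
      · exact h.1.le
    · intro a b hab
      have := Tuple.monotone_sort F hab
      simp only [Function.comp, F, Prod.Lex.le_iff, ofLex_toLex] at this ⊢
      rcases this with h | h
      · by_contra hlt
        push Not at hlt
        exact absurd (hg hlt) (by simpa using h)
      · exact h.2
  obtain ⟨s, hs1, hs2⟩ := key g h1
  obtain ⟨t, ht1, ht2⟩ := key _ h2
  refine ⟨s, t, Tuple.unique_monotone hs1 ht1, ?_⟩
  have := Tuple.unique_monotone (f := g) (σ := s) (τ := t.trans ρ) hs2 ht2
  simpa using this

lemma key_lemma {m r n d d' : ℕ} (p : Fin d → Fin m × Fin n) (c : Fin d → Fin r)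
    (p' : Fin d' → Fin m × Fin n) (c' : Fin d' → Fin r) (hc : cont p c = cont p' c')
    (good : ∀ a b, c a = c b → (p a).2 < (p b).2 → (p a).1 ≤ (p b).1)
    (hw : wt (expo p) ≤ wt (expo p')) : expo p = expo p' := by
  classical
  have e1 : ∀ x, Nonempty ({a // ((p a).1, c a) = x} ≃ {a // ((p' a).1, c' a) = x}) := fun x =>
    Fintype.card_eq.1 (by rw [← cont_inl, ← cont_inl, hc])
  have e2 : ∀ x, Nonempty ({a // (c a, (p a).2) = x} ≃ {a // (c' a, (p' a).2) = x}) := fun x =>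
    Fintype.card_eq.1 (by rw [← cont_inr, ← cont_inr, hc])
  let π : Fin d ≃ Fin d' := Equiv.ofFiberEquiv (fun x => (e1 x).some)
  let π2 : Fin d ≃ Fin d' := Equiv.ofFiberEquiv (fun x => (e2 x).some)
  have hπ : ∀ a, ((p' (π a)).1, c' (π a)) = ((p a).1, c a) :=
    Equiv.ofFiberEquiv_map (fun x => (e1 x).some)
  have hπ2 : ∀ a, (c' (π2 a), (p' (π2 a)).2) = (c a, (p a).2) :=
    Equiv.ofFiberEquiv_map (fun x => (e2 x).some)
  let ρ : Equiv.Perm (Fin d) := π.trans π2.symm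
  have hρ2 : ∀ a, (p' (π a)).2 = (p (ρ a)).2 ∧ c (ρ a) = c a := by
    intro a
    have h := hπ2 (ρ a)
    have h' := hπ a
    simp only [ρ, Equiv.trans_apply, Equiv.apply_symm_apply, Prod.mk.injEq] at h h' ⊢
    exact ⟨h.2, h.1.symm.trans h'.2⟩
  have hp' : ∀ a, p' (π a) = ((p a).1, (p (ρ a)).2) := fun a =>
    Prod.ext (by have := hπ a; simp only [Prod.mk.injEq] at this; exact this.1) (hρ2 a).1
  let B := m + n + 1
  let f : Fin d → ℕ := fun a => (p a).1 + B * c a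
  let g : Fin d → ℕ := fun a => (p a).2 + B * c a
  have hfg : Monovary f g := by
    intro a b hab
    simp only [f, g] at hab ⊢
    have h1 := (p a).1.2
    have h2 := (p b).1.2
    have h3 := (p a).2.2
    have h4 := (p b).2.2
    rcases lt_trichotomy (c a : ℕ) (c b) with h | h | h
    · have : B * (c a + 1) ≤ B * c b := Nat.mul_le_mul_left _ h
      simp only [B] at *
      nlinarith
    · rw [h] at hab ⊢
      have := good a b (Fin.ext h) (by rw [Fin.lt_def]; omega)
      rw [Fin.le_def] at this
      omega
    · have : B * (c b + 1) ≤ B * c a := Nat.mul_le_mul_left _ h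
      simp only [B] at *
      nlinarith
  have hw' : ∑ a, ((p a).1 : ℕ) * ((p a).2 : ℕ) ≤ ∑ a, ((p a).1 : ℕ) * ((p (ρ a)).2 : ℕ) := by
    rw [wt_expo, wt_expo, ← Equiv.sum_comp π] at hw
    simpa only [hp'] using hw
  have hX : ∑ a, ((c a : ℕ) * ((p (ρ a)).2 : ℕ)) = ∑ a, ((c a : ℕ) * ((p a).2 : ℕ)) := by
    rw [← Equiv.sum_comp ρ (fun a => ((c a : ℕ) * ((p a).2 : ℕ)))]
    refine Finset.sum_congr rfl fun a _ => ?_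
    rw [(hρ2 a).2]
  have expand : ∀ a, f a * g (ρ a) = ((p a).1 : ℕ) * ((p (ρ a)).2 : ℕ)
      + B * ((c a : ℕ) * ((p (ρ a)).2 : ℕ)) + (B * ((p a).1 * c a) + B * B * (c a * c a)) := by
    intro a
    simp only [f, g, (hρ2 a).2]
    ring
  have expand' : ∀ a, f a * g a = ((p a).1 : ℕ) * ((p a).2 : ℕ)
      + B * ((c a : ℕ) * ((p a).2 : ℕ)) + (B * ((p a).1 * c a) + B * B * (c a * c a)) := by
    intro a
    simp only [f, g]
    ring
  have heq : ∑ a, f a * g (ρ a) = ∑ a, f a * g a := by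
    apply le_antisymm hfg.sum_mul_comp_perm_le_sum_mul
    simp only [expand, expand', Finset.sum_add_distrib, ← Finset.mul_sum] at *
    rw [hX]
    omega
  have h2 := hfg.sum_mul_comp_perm_eq_sum_mul_iff.1 heq
  obtain ⟨s, t, hs, ht⟩ := sort_lemma f g ρ hfg h2
  have hs' : ∀ a, (p (s a)).1 = (p (t a)).1 := by
    intro a
    have := congrArg (· % B) (congrFun hs a)
    simp only [f, Function.comp, Nat.add_mul_mod_self_left] at this
    rw [Nat.mod_eq_of_lt (by omega), Nat.mod_eq_of_lt (by omega)] at this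
    exact Fin.ext this
  have ht' : ∀ a, (p (s a)).2 = (p (ρ (t a))).2 := by
    intro a
    have := congrArg (· % B) (congrFun ht a)
    simp only [g, Function.comp, Nat.add_mul_mod_self_left] at this
    rw [Nat.mod_eq_of_lt (by omega), Nat.mod_eq_of_lt (by omega)] at this
    exact Fin.ext this
  unfold expo
  rw [← Equiv.sum_comp π, ← Equiv.sum_comp s]
  simp only [hp']
  rw [← Equiv.sum_comp t (fun a => Finsupp.single ((p a).1, (p (ρ a)).2) 1)]
  refine Finset.sum_congr rfl fun a _ => ?_
  rw [← hs', ← ht']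

/-- monomials with no antidiagonal of length `r + 1` -/
def Good {m n : ℕ} (r : ℕ) (e : (Fin m × Fin n) →₀ ℕ) : Prop :=
  ¬ ∃ (u : Fin (r + 1) → Fin m) (v : Fin (r + 1) → Fin n),
    StrictMono u ∧ StrictAnti v ∧ ∀ k, e (u k, v k) ≠ 0

lemma exists_color {m n r : ℕ} (e : (Fin m × Fin n) →₀ ℕ) (h : Good r e) :
    ∃ c : Fin m × Fin n → ℕ, (∀ x, e x ≠ 0 → c x < r) ∧
      ∀ x y, e x ≠ 0 → e y ≠ 0 → c x = c y → x.2 < y.2 → x.1 ≤ y.1 := by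
  classical
  let P : Fin m × Fin n → ℕ → Prop := fun x l =>
    ∃ (u : Fin (l + 1) → Fin m) (v : Fin (l + 1) → Fin n),
      StrictMono u ∧ StrictAnti v ∧ (∀ k, e (u k, v k) ≠ 0) ∧ (u (Fin.last l), v (Fin.last l)) = x
  have hP : ∀ x l, P x l → l < r := by
    rintro x l ⟨u, v, hu, hv, he, -⟩
    by_contra hl
    push Not at hl
    refine h ⟨u ∘ Fin.castLE (by omega), v ∘ Fin.castLE (by omega),
      hu.comp (Fin.strictMono_castLE _), hv.comp_strictMono (Fin.strictMono_castLE _), fun k => he _⟩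
  have hP0 : ∀ x, e x ≠ 0 → P x 0 := by
    intro x hx
    refine ⟨fun _ => x.1, fun _ => x.2, ?_, ?_, fun _ => hx, rfl⟩ <;>
    · intro a b hab
      exact absurd hab (by omega)
  have hPs : ∀ x y l, P x l → e y ≠ 0 → x.1 < y.1 → y.2 < x.2 → P y (l + 1) := by
    rintro x y l ⟨u, v, hu, hv, he, rfl⟩ hy h1 h2
    refine ⟨Fin.snoc u y.1, Fin.snoc v y.2, ?_, ?_, ?_, by simp⟩
    · rw [Fin.strictMono_iff_lt_succ]
      intro i
      induction i using Fin.lastCases with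
      | last => simpa using h1
      | cast i =>
        rw [← Fin.castSucc_succ, Fin.snoc_castSucc, Fin.snoc_castSucc]
        exact hu (Fin.castSucc_lt_succ)
    · rw [Fin.strictAnti_iff_succ_lt]
      intro i
      induction i using Fin.lastCases with
      | last => simpa using h2
      | cast i =>
        rw [← Fin.castSucc_succ, Fin.snoc_castSucc, Fin.snoc_castSucc]
        exact hv (Fin.castSucc_lt_succ)
    · intro k
      induction k using Fin.lastCases with
      | last => simpa using hy
      | cast i => simpa using he i
  let c : Fin m × Fin n → ℕ := fun x => Nat.findGreatest (P x) r
  have hc : ∀ x, e x ≠ 0 → P x (c x) := fun x hx =>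
    Nat.findGreatest_spec (Nat.zero_le r) (hP0 x hx)
  refine ⟨c, fun x hx => hP _ _ (hc x hx), ?_⟩
  intro x y hx hy hxy h2
  by_contra h1
  push Not at h1
  have h3 := hPs y x _ (hc y hy) hx h1 h2
  have h4 := Nat.le_findGreatest (hP _ _ h3).le h3
  change _ ≤ c x at h4
  omega

/-- `X ↦ Y Z` -/
noncomputable def phi (K : Type*) [Field K] (m r n : ℕ) :
    MvPolynomial (Fin m × Fin n) K →ₐ[K] MvPolynomial ((Fin m × Fin r) ⊕ (Fin r × Fin n)) K :=
  aeval fun x => ∑ k, X (Sum.inl (x.1, k)) * X (Sum.inr (k, x.2))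

lemma monomial_expo {σ K : Type*} [Field K] {d : ℕ} (p : Fin d → σ) :
    monomial (expo p) (1 : K) = ∏ a, X (p a) := by
  rw [expo, monomial_sum_one]
  rfl

lemma phi_expo (K : Type*) [Field K] {m r n d : ℕ} (p : Fin d → Fin m × Fin n) :
    phi K m r n (monomial (expo p) 1) = ∑ c : Fin d → Fin r, monomial (cont p c) 1 := by
  classical
  rw [monomial_expo, map_prod]
  simp only [phi, aeval_X]
  rw [Finset.prod_univ_sum, Fintype.piFinset_univ]
  refine Finset.sum_congr rfl fun c _ => ?_
  rw [cont, monomial_sum_one]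
  refine Finset.prod_congr rfl fun a _ => ?_
  rw [X, X, monomial_mul, one_mul]

lemma coeff_phi_expo (K : Type*) [Field K] {m r n d : ℕ} (p : Fin d → Fin m × Fin n) (μ) :
    coeff μ (phi K m r n (monomial (expo p) 1)) =
      ((univ.filter fun c : Fin d → Fin r => cont p c = μ).card : K) := by
  classical
  rw [phi_expo, coeff_sum]
  simp [coeff_monomial]

lemma phi_eq_sum (K : Type*) [Field K] {m r n : ℕ} (f : MvPolynomial (Fin m × Fin n) K) :
    phi K m r n f = ∑ e ∈ f.support, C (coeff e f) * phi K m r n (monomial e 1) := by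
  conv_lhs => rw [f.as_sum, map_sum]
  refine Finset.sum_congr rfl fun e _ => ?_
  have : monomial e (coeff e f) = C (coeff e f) * monomial e (1 : K) := by simp [C_mul_monomial]
  rw [this, map_mul]
  congr 1
  exact (phi K m r n).commutes _

lemma indep {K : Type*} [Field K] [CharZero K] {m r n : ℕ} (f : MvPolynomial (Fin m × Fin n) K)
    (hg : ∀ e ∈ f.support, Good r e) (hf : phi K m r n f = 0) : f = 0 := by
  classical
  by_contra hne
  obtain ⟨e, he, hmin⟩ := Finset.exists_min_image f.support wt (by simpa using hne)
  obtain ⟨d, p, rfl⟩ := exists_expo e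
  obtain ⟨c, hc1, hc2⟩ := exists_color _ (hg _ he)
  let c' : Fin d → Fin r := fun a => ⟨c (p a), hc1 _ (expo_ne_zero p a)⟩
  have h0 : coeff (cont p c') (phi K m r n f) = 0 := by rw [hf, coeff_zero]
  rw [phi_eq_sum, coeff_sum, Finset.sum_eq_single (expo p)] at h0
  · rw [coeff_C_mul, coeff_phi_expo] at h0
    rcases mul_eq_zero.1 h0 with h | h
    · exact (mem_support_iff.1 he) h
    · rw [Nat.cast_eq_zero, Finset.card_eq_zero] at h
      have : c' ∈ (univ.filter fun c : Fin d → Fin r => cont p c = cont p c') := by simp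
      rw [h] at this
      simp at this
  · intro e' he' hne'
    obtain ⟨d', p', rfl⟩ := exists_expo e'
    rw [coeff_C_mul, coeff_phi_expo, Finset.filter_eq_empty_iff.2]
    · simp
    · intro c'' _ hcc
      refine hne' (key_lemma p c' p' c'' hcc.symm ?_ (hmin _ he')).symm
      intro a b hab h2
      refine hc2 _ _ (expo_ne_zero p a) (expo_ne_zero p b) ?_ h2
      simpa [c'] using hab
  · intro h
    exact absurd he h

lemma wt_le {m n d : ℕ} (p : Fin d → Fin m × Fin n) : wt (expo p) ≤ d * (m * n) := by
  rw [wt_expo]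
  calc _ ≤ ∑ a : Fin d, m * n := Finset.sum_le_sum fun a _ =>
        Nat.mul_le_mul (p a).1.2.le (p a).2.2.le
    _ = _ := by simp

/-- degree -/
lemma wt_le' {m n : ℕ} (e : (Fin m × Fin n) →₀ ℕ) : wt e ≤ e.degree * (m * n) := by
  obtain ⟨d, p, rfl⟩ := exists_expo e
  have : (expo p).degree = d := by simp [expo]
  rw [this]
  exact wt_le p

lemma strict_wt {m n l : ℕ} (u : Fin l → Fin m) (v : Fin l → Fin n) (hu : StrictMono u)
    (hv : StrictAnti v) (σ : Equiv.Perm (Fin l)) (hσ : σ ≠ 1) :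
    wt (expo fun k => (u k, v k)) < wt (expo fun k => (u (σ k), v k)) := by
  rw [wt_expo, wt_expo]
  have h : Antivary (fun k => (u k : ℕ)) (fun k => (v k : ℕ)) := by
    intro a b hab
    have : v a < v b := hab
    exact hu.monotone (hv.lt_iff_gt.1 this).le
  refine (h.sum_mul_lt_sum_comp_perm_mul_iff (σ := σ)).2 fun h' => hσ ?_
  have hm : StrictMono (⇑σ) := by
    refine Monotone.strictMono_of_injective ?_ σ.injective
    intro a b hab
    rcases hab.eq_or_lt with rfl | hab
    · exact le_rfl
    · have := h' (i := b) (j := a) (hv hab)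
      exact hu.le_iff_le.1 this
  have h1 := Tuple.unique_monotone (f := (id : Fin l → Fin l)) (σ := σ) (τ := 1) hm.monotone
    monotone_id
  ext a
  exact congrArg Fin.val (congrFun h1 a)

lemma reduce (K : Type*) [Field K] (m r n : ℕ) (e : (Fin m × Fin n) →₀ ℕ) :
    monomial e (1 : K) ∈ (genericMinors K m n (r + 1)).restrictScalars K ⊔
      restrictSupport K {e | Good r e} := by
  classical
  induction hk : e.degree * (m * n) - wt e using Nat.strong_induction_on generalizing e with
  | _ k ih =>
  by_cases hg : Good r e
  · refine Submodule.mem_sup_right ?_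
    rw [mem_restrictSupport_iff]
    intro x hx
    rw [Finset.mem_coe, mem_support_iff, coeff_monomial] at hx
    have : e = x := by by_contra h; simp [h] at hx
    exact this ▸ hg
  · unfold Good at hg
    push Not at hg
    obtain ⟨u, v, hu, hv, he⟩ := hg
    set q : (Fin m × Fin n) →₀ ℕ := expo fun k => (u k, v k) with hq
    have hle : q ≤ e := by
      intro x
      rw [hq, expo_apply]
      by_cases hx : ∃ k, (u k, v k) = x
      · obtain ⟨k, rfl⟩ := hx
        refine le_trans ?_ (Nat.one_le_iff_ne_zero.2 (he k))
        rw [Fintype.card_le_one_iff_subsingleton]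
        constructor
        rintro ⟨a, ha⟩ ⟨b, hb⟩
        apply Subtype.ext
        simp only [Prod.mk.injEq] at ha hb
        exact hu.injective (ha.1.trans hb.1.symm)
      · rw [Fintype.card_eq_zero_iff.2]
        · exact Nat.zero_le _
        · exact ⟨fun a => hx ⟨a.1, a.2⟩⟩
    obtain ⟨e0, rfl⟩ := exists_add_of_le hle
    let D : MvPolynomial (Fin m × Fin n) K :=
      Matrix.det (Matrix.of fun i j => (X (u i, v j) : MvPolynomial (Fin m × Fin n) K))
    have hD : D ∈ genericMinors K m n (r + 1) :=
      Ideal.subset_span ⟨u, v, hu.injective, hv.injective, rfl⟩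
    have hD2 : monomial e0 (1 : K) * D = monomial (q + e0) 1 +
        ∑ σ ∈ univ.erase (1 : Equiv.Perm (Fin (r + 1))), (((Equiv.Perm.sign σ : ℤ) : K)) •
          monomial ((expo fun k => (u (σ k), v k)) + e0) (1 : K) := by
      simp only [D]
      rw [Matrix.det_apply, ← Finset.add_sum_erase _ _ (Finset.mem_univ 1), mul_add, Finset.mul_sum]
      congr 1
      · simp only [Equiv.Perm.sign_one, one_smul, Matrix.of_apply, Equiv.Perm.one_apply]
        rw [← monomial_expo (fun k => (u k, v k)), monomial_mul, one_mul, add_comm]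
      · refine Finset.sum_congr rfl fun σ _ => ?_
        simp only [Matrix.of_apply]
        rw [← monomial_expo (fun k => (u (σ k), v k)), Units.smul_def, mul_smul_comm, monomial_mul,
          one_mul, add_comm e0, Int.cast_smul_eq_zsmul]
    have : monomial (q + e0) (1 : K) = monomial e0 (1 : K) * D -
        ∑ σ ∈ univ.erase (1 : Equiv.Perm (Fin (r + 1))), (((Equiv.Perm.sign σ : ℤ) : K)) •
          monomial ((expo fun k => (u (σ k), v k)) + e0) (1 : K) := by
      rw [hD2]; ring
    rw [this]
    refine Submodule.sub_mem _ (Submodule.mem_sup_left ?_) (Submodule.sum_mem _ fun σ hσ => ?_)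
    · exact Ideal.mul_mem_left _ _ hD
    · refine Submodule.smul_mem _ _ (ih _ ?_ _ rfl)
      have hs := strict_wt u v hu hv σ (Finset.ne_of_mem_erase hσ)
      rw [← hq] at hs
      have hdeg : ((expo fun k => (u (σ k), v k)) + e0).degree = (q + e0).degree := by
        simp [hq, expo]
      have hb := wt_le' ((expo fun k => (u (σ k), v k)) + e0)
      rw [hdeg] at hb ⊢
      rw [wt_add] at hb
      rw [wt_add] at hk ⊢
      omega

lemma exists_good (K : Type*) [Field K] (m r n : ℕ) (f : MvPolynomial (Fin m × Fin n) K) :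
    ∃ g h, g ∈ genericMinors K m n (r + 1) ∧ (∀ e ∈ h.support, Good r e) ∧ g + h = f := by
  have hf : f ∈ (genericMinors K m n (r + 1)).restrictScalars K ⊔
      restrictSupport K {e | Good r e} := by
    rw [f.as_sum]
    refine Submodule.sum_mem _ fun e _ => ?_
    have : monomial e (coeff e f) = coeff e f • monomial e (1 : K) := by simp [smul_monomial]
    rw [this]
    exact Submodule.smul_mem _ _ (reduce K m r n e)
  obtain ⟨g, hg, h, hh, rfl⟩ := Submodule.mem_sup.1 hf
  rw [mem_restrictSupport_iff] at hh
  exact ⟨g, h, hg, fun e he => hh he, rfl⟩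

lemma det_YZ_zero {A : Type*} [CommRing A] {r : ℕ} (Y : Matrix (Fin (r + 1)) (Fin r) A)
    (Z : Matrix (Fin r) (Fin (r + 1)) A) : (Y * Z).det = 0 := by
  let Y' : Matrix (Fin (r + 1)) (Fin (r + 1)) A := Matrix.of fun i => Fin.snoc (Y i) 0
  let Z' : Matrix (Fin (r + 1)) (Fin (r + 1)) A := Matrix.of fun k j =>
    Fin.snoc (α := fun _ => A) (fun k => Z k j) 0 k
  have : Y * Z = Y' * Z' := by
    ext i j
    simp [Matrix.mul_apply, Fin.sum_univ_castSucc, Y', Z']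
  rw [this, Matrix.det_mul]
  have : Y'.det = 0 := Matrix.det_eq_zero_of_column_eq_zero (Fin.last r) (by simp [Y'])
  rw [this, zero_mul]

lemma ker_phi (K : Type*) [Field K] [CharZero K] (m r n : ℕ) :
    RingHom.ker (phi K m r n) = genericMinors K m n (r + 1) := by
  have h1 : genericMinors K m n (r + 1) ≤ RingHom.ker (phi K m r n) := by
    rw [genericMinors, Ideal.span_le]
    rintro _ ⟨u, v, -, -, rfl⟩
    simp only [SetLike.mem_coe, RingHom.mem_ker]
    rw [AlgHom.map_det]
    convert det_YZ_zero (Matrix.of fun i k => (X (Sum.inl (u i, k)) :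
      MvPolynomial ((Fin m × Fin r) ⊕ (Fin r × Fin n)) K))
      (Matrix.of fun k j => X (Sum.inr (k, v j)))
    ext1 i j
    simp [Matrix.mul_apply, phi]
  refine le_antisymm ?_ h1
  intro f hf
  obtain ⟨g, h, hg, hh, rfl⟩ := exists_good K m r n f
  have : phi K m r n h = 0 := by
    have h2 := h1 hg
    rw [RingHom.mem_ker] at hf h2
    rw [map_add, h2, zero_add] at hf
    exact hf
  rw [indep h hh this, add_zero]
  exact hg

instance prime_minors (K : Type*) [Field K] [CharZero K] (m r n : ℕ) :
    (genericMinors K m n (r + 1)).IsPrime := by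
  rw [← ker_phi]
  exact RingHom.ker_isPrime _

lemma mem_symb {R : Type*} [CommRing R] [IsNoetherianRing R] (I : Ideal R) [hI : I.IsPrime]
    (s : ℕ) (f : R) : f ∈ symbolicPower I s ↔ ∃ u, u ∉ I ∧ u * f ∈ I ^ s := by
  have hass : associatedPrimes R (R ⧸ I) = {I} := by
    rw [associatedPrimes.eq_singleton_of_isPrimary hI.isPrimary, hI.radical]
  have key : ∀ (p : Ideal R) (hp : p.IsPrime), p = I →
      (f ∈ Ideal.comap (algebraMap R (Localization.AtPrime p))
        (Ideal.map (algebraMap R (Localization.AtPrime p)) (I ^ s)) ↔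
        ∃ u, u ∉ I ∧ u * f ∈ I ^ s) := by
    rintro p hp rfl
    rw [Ideal.mem_comap, IsLocalization.algebraMap_mem_map_algebraMap_iff p.primeCompl]
    constructor
    · rintro ⟨u, hu, h⟩
      exact ⟨u, hu, h⟩
    · rintro ⟨u, hu, h⟩
      exact ⟨u, hu, h⟩
  unfold symbolicPower
  rw [Ideal.mem_iInf]
  constructor
  · intro h
    have hmem : I ∈ associatedPrimes R (R ⧸ I) := by rw [hass]; rfl
    exact (key I hI rfl).1 (h ⟨I, hmem⟩)
  · rintro h ⟨p, hp⟩
    have hpI : p = I := by rw [hass] at hp; exact hp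
    exact (key p hp.isPrime hpI).2 h

/-- scaling of variables by powers of `T` -/
noncomputable def tau {σ K : Type*} [Field K] (w : σ → ℕ) :
    MvPolynomial σ K →ₐ[K] Polynomial (MvPolynomial σ K) :=
  aeval fun x => Polynomial.C (X x) * Polynomial.X ^ w x

lemma tau_monomial {σ K : Type*} [Field K] (w : σ → ℕ) (ν : σ →₀ ℕ) (a : K) :
    tau w (monomial ν a) =
      Polynomial.C (monomial ν a) * Polynomial.X ^ (ν.sum fun x k => w x * k) := by
  rw [tau, aeval_monomial, monomial_eq, Finsupp.prod, map_mul, Finsupp.prod, Finsupp.sum,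
    ← Finset.prod_pow_eq_pow_sum, map_prod, mul_assoc, ← Finset.prod_mul_distrib]
  congr 1
  refine Finset.prod_congr rfl fun x _ => ?_
  rw [mul_pow, map_pow, pow_mul]

lemma coeff_tau {σ K : Type*} [Field K] (w : σ → ℕ) (F : MvPolynomial σ K) (ν : σ →₀ ℕ) (l : ℕ) :
    coeff ν ((tau w F).coeff l) = if (ν.sum fun x k => w x * k) = l then coeff ν F else 0 := by
  classical
  induction F using MvPolynomial.induction_on' with
  | monomial e a =>
    rw [tau_monomial, Polynomial.coeff_C_mul, Polynomial.coeff_X_pow, coeff_monomial]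
    by_cases h : e = ν
    · subst h
      by_cases h2 : l = e.sum fun x k => w x * k
      · rw [if_pos h2, if_pos h2.symm]; simp
      · rw [if_neg h2, if_neg (Ne.symm h2)]; simp
    · simp only [h, if_false, ite_self]
      split_ifs <;> simp [coeff_monomial, h]
  | add p q hp hq =>
    rw [map_add, Polynomial.coeff_add, coeff_add, hp, hq, coeff_add]
    split_ifs <;> simp

/-- the weight detecting the columns `S` of `Y` -/
def wS (m n : ℕ) (S : Finset (Fin m)) : (Fin m × Fin m) ⊕ (Fin m × Fin n) → ℕ
  | Sum.inl x => if x.2 ∈ S then 1 else 0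
  | Sum.inr _ => 0

lemma const_tau (K : Type*) [Field K] {m r n : ℕ} (S : Finset (Fin m)) (hS : S.card + r = m)
    (f : MvPolynomial (Fin m × Fin n) K) :
    (tau (wS m n S) (phi K m m n f)).coeff 0 = 0 ↔ phi K m r n f = 0 := by
  classical
  have hcard : Fintype.card {k : Fin m // k ∉ S} = r := by
    rw [Fintype.card_subtype_compl]
    simp
    omega
  let ε : Fin r ≃ {k : Fin m // k ∉ S} := (Fintype.equivFinOfCardEq hcard).symm
  let ρ : ((Fin m × Fin r) ⊕ (Fin r × Fin n)) → ((Fin m × Fin m) ⊕ (Fin m × Fin n)) :=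
    Sum.map (Prod.map id (fun k => (ε k : Fin m))) (Prod.map (fun k => (ε k : Fin m)) id)
  have hε : Function.Injective (fun k => (ε k : Fin m)) :=
    Subtype.val_injective.comp ε.injective
  have hρ : Function.Injective ρ :=
    (Function.injective_id.prodMap hε).sumMap (hε.prodMap Function.injective_id)
  have hcomp : ((Polynomial.constantCoeff (R := MvPolynomial ((Fin m × Fin m) ⊕ (Fin m × Fin n)) K)).comp
      ((tau (wS m n S)).comp (phi K m m n)).toRingHom) =
      ((rename ρ).comp (phi K m r n)).toRingHom := by
    apply MvPolynomial.ringHom_ext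
    · intro a
      simp [phi, tau, MvPolynomial.algebraMap_eq]
    · intro x
      simp only [AlgHom.toRingHom_eq_coe, RingHom.comp_apply, RingHom.coe_coe, AlgHom.comp_apply,
        phi, aeval_X, map_sum, map_mul, tau, rename_X]
      simp only [ρ, wS, Sum.map_inl, Sum.map_inr, Prod.map, id, pow_zero, map_one, mul_one,
        map_pow, Polynomial.constantCoeff_apply, Polynomial.coeff_C_zero, Polynomial.coeff_X_zero]
      rw [← Finset.sum_filter_add_sum_filter_not univ (fun k => k ∈ S)]
      rw [Finset.sum_eq_zero, zero_add]
      · rw [Finset.sum_subtype (p := fun k => k ∉ S) _ (by simp), ← Equiv.sum_comp ε]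
        refine Finset.sum_congr rfl fun k _ => ?_
        rw [if_neg (ε k).2]; simp
      · intro k hk
        rw [if_pos (Finset.mem_filter.1 hk).2]; simp
  have h := congrArg (fun g => g f) hcomp
  simp only [AlgHom.toRingHom_eq_coe, RingHom.comp_apply, RingHom.coe_coe, AlgHom.comp_apply,
    Polynomial.constantCoeff_apply] at h
  rw [h]
  exact map_eq_zero_iff _ (rename_injective ρ hρ)

lemma phi_inj (K : Type*) [Field K] {m n : ℕ} (f : MvPolynomial (Fin m × Fin n) K)
    (hf : phi K m m n f = 0) : f = 0 := by
  let sp : MvPolynomial ((Fin m × Fin m) ⊕ (Fin m × Fin n)) K →ₐ[K]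
      MvPolynomial (Fin m × Fin n) K :=
    aeval (Sum.elim (fun x => if x.1 = x.2 then 1 else 0) X)
  have : sp.comp (phi K m m n) = AlgHom.id K _ := by
    ext1 x
    simp [sp, phi]
  have h := congrArg (fun g => g f) this
  simp only [AlgHom.comp_apply, hf, map_zero, AlgHom.id_apply] at h
  exact h.symm

lemma supp_phi (K : Type*) [Field K] {m r n d : ℕ} (f : MvPolynomial (Fin m × Fin n) K)
    (hf : f.IsHomogeneous d) (ν) (hν : coeff ν (phi K m r n f) ≠ 0) :
    ∑ k, ∑ i, ν (Sum.inl (i, k)) = d := by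
  classical
  rw [phi_eq_sum, coeff_sum] at hν
  obtain ⟨e, he, h⟩ := Finset.exists_ne_zero_of_sum_ne_zero hν
  obtain ⟨d', p, rfl⟩ := exists_expo e
  have hd : d' = d := by
    have := hf (mem_support_iff.1 he)
    rw [← this]
    simp [expo, Finsupp.weight_single]
  rw [coeff_C_mul, coeff_phi_expo] at h
  have h2 := right_ne_zero_of_mul h
  have h3 : (univ.filter fun c : Fin d' → Fin r => cont p c = ν).Nonempty := by
    rw [Finset.nonempty_iff_ne_empty]
    intro h4
    rw [h4] at h2
    simp at h2
  obtain ⟨c, hc⟩ := h3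
  rw [Finset.mem_filter] at hc
  rw [← hc.2, ← hd, Finset.sum_comm]
  rw [← Finset.sum_product' (f := fun i k => cont p c (Sum.inl (i, k)))]
  simp only [cont_inl]
  simp only [Fintype.card_subtype, Prod.mk.eta]
  rw [Finset.univ_product_univ, ← Finset.card_eq_sum_card_fiberwise (by simp)]
  simp

lemma lower {K : Type*} [Field K] [CharZero K] {m r n s d c : ℕ} (hc : c + r = m) (hm : 0 < m)
    (f : MvPolynomial (Fin m × Fin n) K)
    (hf : f ∈ symbolicPower (genericMinors K m n (r + 1)) s) (h0 : f ≠ 0)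
    (hd : f.IsHomogeneous d) : m * s ≤ c * d := by
  classical
  rw [mem_symb] at hf
  obtain ⟨u, hu, huf⟩ := hf
  have hF : phi K m m n f ≠ 0 := fun h => h0 (phi_inj K f h)
  obtain ⟨ν, hν⟩ := MvPolynomial.ne_zero_iff.1 hF
  have hdeg := supp_phi K f hd ν hν
  have hS : ∀ S : Finset (Fin m), S.card = c → s ≤ ∑ k ∈ S, ∑ i, ν (Sum.inl (i, k)) := by
    intro S hSc
    let θ := ((tau (K := K) (wS m n S)).comp (phi K m m n))
    have hθI : (genericMinors K m n (r + 1)).map θ ≤ Ideal.span {Polynomial.X} := by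
      rw [Ideal.map_le_iff_le_comap]
      intro g hg
      rw [← ker_phi, RingHom.mem_ker, ← const_tau K S (by omega)] at hg
      rw [Ideal.mem_comap, Ideal.mem_span_singleton, Polynomial.X_dvd_iff]
      exact hg
    have h1 : Polynomial.X ^ s ∣ θ u * θ f := by
      rw [← map_mul, ← Ideal.mem_span_singleton, ← Ideal.span_singleton_pow]
      refine Ideal.pow_right_mono hθI s ?_
      rw [← Ideal.map_pow]
      exact Ideal.mem_map_of_mem _ huf
    have h2 : ¬ Polynomial.X ∣ θ u := by
      rw [Polynomial.X_dvd_iff]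
      intro h
      apply hu
      rw [← ker_phi, RingHom.mem_ker, ← const_tau K S (by omega)]
      exact h
    have h3 : Polynomial.X ^ s ∣ θ f := Polynomial.prime_X.pow_dvd_of_dvd_mul_left s h2 h1
    rw [Polynomial.X_pow_dvd_iff] at h3
    by_contra hlt
    push Not at hlt
    have h4 := h3 _ hlt
    have h5 := coeff_tau (wS m n S) (phi K m m n f) ν (∑ k ∈ S, ∑ i, ν (Sum.inl (i, k)))
    change coeff ν ((θ f).coeff _) = _ at h5
    rw [h4, coeff_zero, if_pos] at h5
    · exact hν h5.symm
    · rw [Finsupp.sum_fintype _ _ (by simp), Fintype.sum_sum_type]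
      simp only [wS, zero_mul, Finset.sum_const_zero, add_zero, ite_mul, one_mul]
      rw [Fintype.sum_prod_type_right]
      refine Eq.trans (b := ∑ x, if x ∈ S then ∑ i, ν (Sum.inl (i, x)) else 0) ?_ (by simp)
      refine Finset.sum_congr rfl fun x _ => ?_
      split_ifs <;> simp
  have : NeZero m := ⟨hm.ne'⟩
  have hcm : c ≤ m := by omega
  set a : Fin m → ℕ := fun k => ∑ i, ν (Sum.inl (i, k)) with ha
  have h6 : ∀ i : Fin m, s ≤ ∑ l : Fin c, a (i + Fin.castLE hcm l) := by
    intro i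
    have hinj : Function.Injective (fun l : Fin c => i + Fin.castLE hcm l) :=
      (add_right_injective i).comp (Fin.castLE_injective hcm)
    have := hS (univ.image fun l : Fin c => i + Fin.castLE hcm l)
      (by rw [Finset.card_image_of_injective _ hinj]; simp)
    rwa [Finset.sum_image (fun x _ y _ h => hinj h)] at this
  calc m * s = ∑ i : Fin m, s := by simp
    _ ≤ ∑ i : Fin m, ∑ l : Fin c, a (i + Fin.castLE hcm l) := Finset.sum_le_sum fun i _ => h6 i
    _ = ∑ l : Fin c, ∑ i : Fin m, a (i + Fin.castLE hcm l) := Finset.sum_comm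
    _ = ∑ l : Fin c, d := by
        refine Finset.sum_congr rfl fun l _ => ?_
        rw [← hdeg]
        exact Equiv.sum_comp (Equiv.addRight (Fin.castLE hcm l)) a
    _ = c * d := by simp

lemma alpha_I_ge {K : Type*} [Field K] [CharZero K] {m r n d : ℕ}
    (f : MvPolynomial (Fin m × Fin n) K)
    (hf : f ∈ genericMinors K m n (r + 1)) (h0 : f ≠ 0)
    (hd : f.IsHomogeneous d) : r + 1 ≤ d := by
  classical
  by_contra hlt
  push Not at hlt
  refine h0 (indep (r := r) f ?_ (by rwa [← ker_phi, RingHom.mem_ker] at hf))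
  rintro e he ⟨u, v, hu, hv, h⟩
  have hdeg := hd (mem_support_iff.1 he)
  rw [Pi.one_def, Finsupp.weight_apply, Finsupp.sum_fintype _ _ (by simp)] at hdeg
  simp only [smul_eq_mul, mul_one] at hdeg
  have hinj : Function.Injective fun k => (u k, v k) := fun a b hab => by
    simp only [Prod.mk.injEq] at hab
    exact hu.injective hab.1
  have : ∑ k : Fin (r + 1), 1 ≤ d := by
    rw [← hdeg]
    calc ∑ k : Fin (r + 1), 1 ≤ ∑ k : Fin (r + 1), e (u k, v k) :=
          Finset.sum_le_sum fun k _ => Nat.one_le_iff_ne_zero.2 (h k)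
      _ = ∑ x ∈ univ.image (fun k => (u k, v k)), e x :=
          (Finset.sum_image (fun x _ y _ h => hinj h)).symm
      _ ≤ _ := Finset.sum_le_sum_of_subset (Finset.subset_univ _)
  simp at this
  omega

lemma det_homog {K : Type*} [Field K] {m n : ℕ} {ι : Type*} [Fintype ι] [DecidableEq ι]
    (u : ι → Fin m) (v : ι → Fin n) :
    (Matrix.det (Matrix.of fun a b => (X (u a, v b) : MvPolynomial (Fin m × Fin n) K))).IsHomogeneous
      (Fintype.card ι) := by
  rw [Matrix.det_apply']
  refine IsHomogeneous.sum _ _ _ fun σ _ => ?_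
  have h1 : ((((Equiv.Perm.sign σ : ℤˣ) : ℤ) : MvPolynomial (Fin m × Fin n) K)).IsHomogeneous 0 := by
    rw [← map_intCast (C : K →+* MvPolynomial (Fin m × Fin n) K)]
    exact isHomogeneous_C _ _
  have h2 := IsHomogeneous.prod univ
    (fun i => (X (u (σ i), v i) : MvPolynomial (Fin m × Fin n) K)) (fun _ => 1)
    (fun i _ => isHomogeneous_X _ _)
  have h3 := h1.mul h2
  simpa using h3

lemma det_ne {K : Type*} [Field K] {m n : ℕ} {ι : Type*} [Fintype ι] [DecidableEq ι]
    (u : ι → Fin m) (v : ι → Fin n) (hu : Function.Injective u) (huv : ∀ a, (u a : ℕ) = v a) :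
    (Matrix.det (Matrix.of fun a b => (X (u a, v b) : MvPolynomial (Fin m × Fin n) K))) ≠ 0 := by
  intro h
  let ev : MvPolynomial (Fin m × Fin n) K →ₐ[K] K :=
    aeval fun x => if (x.1 : ℕ) = x.2 then 1 else 0
  have h1 := congrArg ev h
  rw [AlgHom.map_det, map_zero] at h1
  have : ev.mapMatrix (Matrix.of fun a b => (X (u a, v b) : MvPolynomial (Fin m × Fin n) K)) = 1 := by
    ext a b
    simp only [ev, AlgHom.mapMatrix_apply, Matrix.map_apply, Matrix.of_apply, aeval_X,
      Matrix.one_apply, ← huv]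
    by_cases hab : a = b
    · simp [hab]
    · have : (u a : ℕ) ≠ u b := fun h => hab (hu (Fin.ext h))
      simp [hab, this]
  rw [this, Matrix.det_one] at h1
  exact one_ne_zero h1

lemma block_identity {R : Type*} [CommRing R] {r j : ℕ} (A : Matrix (Fin r) (Fin r) R)
    (B : Matrix (Fin r) (Fin j) R) (C : Matrix (Fin j) (Fin r) R) (D : Matrix (Fin j) (Fin j) R) :
    (A.adjugate.det * A.det ^ j) * (Matrix.fromBlocks A B C D).det =
      A.det ^ r * (A.det • D - C * A.adjugate * B).det := by
  have h : Matrix.fromBlocks A B C D *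
      Matrix.fromBlocks A.adjugate (-(A.adjugate * B)) 0 (A.det • (1 : Matrix (Fin j) (Fin j) R)) =
      Matrix.fromBlocks (A.det • (1 : Matrix (Fin r) (Fin r) R)) 0 (C * A.adjugate)
        (A.det • D - C * A.adjugate * B) := by
    rw [Matrix.fromBlocks_multiply]
    congr 1
    · rw [Matrix.mul_adjugate]; simp
    · rw [Matrix.mul_neg, ← Matrix.mul_assoc, Matrix.mul_adjugate]; simp
    · simp
    · rw [Matrix.mul_neg, ← Matrix.mul_assoc]
      simp only [Matrix.mul_smul, Matrix.mul_one]
      abel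
  have h2 := congrArg Matrix.det h
  rw [Matrix.det_mul, Matrix.det_fromBlocks_zero₂₁, Matrix.det_fromBlocks_zero₁₂, Matrix.det_smul,
    Matrix.det_smul] at h2
  simp only [Matrix.det_one, mul_one, Fintype.card_fin] at h2
  rw [← h2]
  ring

lemma det_mem_pow {R : Type*} [CommRing R] (I : Ideal R) {j : ℕ} (E : Matrix (Fin j) (Fin j) R)
    (hE : ∀ a b, E a b ∈ I) : E.det ∈ I ^ j := by
  rw [Matrix.det_apply']
  refine Ideal.sum_mem _ fun σ _ => Ideal.mul_mem_left _ _ ?_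
  have := Ideal.prod_mem_prod (s := univ) (I := fun _ : Fin j => I) (x := fun i => E (σ i) i)
    (fun i _ => hE _ _)
  simpa using this

lemma entry_mem {K : Type*} [Field K] [CharZero K] {m r n j : ℕ} (i1 : Fin r → Fin m)
    (i2 : Fin j → Fin m) (k1 : Fin r → Fin n) (k2 : Fin j → Fin n) (a b : Fin j) :
    let R := MvPolynomial (Fin m × Fin n) K
    let A : Matrix (Fin r) (Fin r) R := Matrix.of fun a b => X (i1 a, k1 b)
    let B : Matrix (Fin r) (Fin j) R := Matrix.of fun a b => X (i1 a, k2 b)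
    let C : Matrix (Fin j) (Fin r) R := Matrix.of fun a b => X (i2 a, k1 b)
    let D : Matrix (Fin j) (Fin j) R := Matrix.of fun a b => X (i2 a, k2 b)
    (A.det • D - C * A.adjugate * B) a b ∈ genericMinors K m n (r + 1) := by
  intro R A B C D
  let R' := MvPolynomial ((Fin m × Fin r) ⊕ (Fin r × Fin n)) K
  let Y1 : Matrix (Fin r) (Fin r) R' := Matrix.of fun a k => X (Sum.inl (i1 a, k))
  let Y2 : Matrix (Fin j) (Fin r) R' := Matrix.of fun a k => X (Sum.inl (i2 a, k))
  let Z1 : Matrix (Fin r) (Fin r) R' := Matrix.of fun k b => X (Sum.inr (k, k1 b))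
  let Z2 : Matrix (Fin r) (Fin j) R' := Matrix.of fun k b => X (Sum.inr (k, k2 b))
  let φ : R →+* R' := (phi K m r n : R →+* R')
  have hA : A.map φ = Y1 * Z1 := by
    ext1 a b; rw [Matrix.mul_apply]; exact aeval_X _ _
  have hB : B.map φ = Y1 * Z2 := by
    ext1 a b; rw [Matrix.mul_apply]; exact aeval_X _ _
  have hC : C.map φ = Y2 * Z1 := by
    ext1 a b; rw [Matrix.mul_apply]; exact aeval_X _ _
  have hD : D.map φ = Y2 * Z2 := by
    ext1 a b; rw [Matrix.mul_apply]; exact aeval_X _ _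
  have hadj : A.adjugate.map φ = (Y1 * Z1).adjugate := by
    rw [← hA]
    exact RingHom.map_adjugate φ A
  have hdet : φ A.det = (Y1 * Z1).det := by
    rw [← hA]
    exact RingHom.map_det φ A
  rw [← ker_phi, RingHom.mem_ker]
  change φ _ = 0
  rw [Matrix.sub_apply, Matrix.smul_apply, smul_eq_mul, map_sub, map_mul]
  have h1 : φ (D a b) = (Y2 * Z2) a b := by rw [← hD]; rfl
  have h2 : φ ((C * A.adjugate * B) a b) = ((Y1 * Z1).det • (Y2 * Z2)) a b := by
    have : φ ((C * A.adjugate * B) a b) = ((C * A.adjugate * B).map φ) a b := rfl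
    rw [this, Matrix.map_mul, Matrix.map_mul, hC, hB, hadj, Matrix.adjugate_mul_distrib]
    have h3 : Y2 * Z1 * (Z1.adjugate * Y1.adjugate) * (Y1 * Z2) =
        Y2 * ((Z1 * Z1.adjugate) * ((Y1.adjugate * Y1) * Z2)) := by
      simp only [Matrix.mul_assoc]
    rw [h3, Matrix.mul_adjugate, Matrix.adjugate_mul, Matrix.det_mul]
    simp only [Matrix.smul_mul, Matrix.one_mul, Matrix.mul_smul, smul_smul]
  rw [h1, h2, hdet, Matrix.smul_apply, smul_eq_mul, sub_self]

lemma minor_mem {K : Type*} [Field K] [CharZero K] {m r n j : ℕ} (hj : r + j ≤ m) (hmn : m ≤ n) :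
    ∃ f ∈ symbolicPower (genericMinors K m n (r + 1)) j, f ≠ 0 ∧ f.IsHomogeneous (r + j) := by
  let u : Fin r ⊕ Fin j → Fin m := fun a => Fin.castLE hj (finSumFinEquiv a)
  let v : Fin r ⊕ Fin j → Fin n := fun a => Fin.castLE hmn (u a)
  have hu : Function.Injective u := (Fin.castLE_injective hj).comp finSumFinEquiv.injective
  refine ⟨Matrix.det (Matrix.of fun a b => X (u a, v b)), ?_, det_ne u v hu fun a => rfl, ?_⟩
  · rw [mem_symb]
    let A : Matrix (Fin r) (Fin r) (MvPolynomial (Fin m × Fin n) K) :=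
      Matrix.of fun a b => X (u (Sum.inl a), v (Sum.inl b))
    have hA : A.det ∉ genericMinors K m n (r + 1) := by
      intro h
      have h1 := alpha_I_ge A.det h
        (det_ne (fun a => u (Sum.inl a)) (fun a => v (Sum.inl a)) (hu.comp Sum.inl_injective)
          fun a => rfl) (det_homog (fun a => u (Sum.inl a)) (fun a => v (Sum.inl a)))
      simp at h1
    have hP : (genericMinors K m n (r + 1)).IsPrime := inferInstance
    refine ⟨A.adjugate.det * A.det ^ j, ?_, ?_⟩
    · rw [Matrix.det_adjugate]
      intro h
      rcases hP.mem_or_mem h with h | h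
      · exact hA (hP.mem_of_pow_mem _ h)
      · exact hA (hP.mem_of_pow_mem _ h)
    · have := block_identity A (Matrix.of fun a b => X (u (Sum.inl a), v (Sum.inr b)))
        (Matrix.of fun a b => X (u (Sum.inr a), v (Sum.inl b)))
        (Matrix.of fun a b => X (u (Sum.inr a), v (Sum.inr b)))
      have hM : (Matrix.of fun a b => (X (u a, v b) : MvPolynomial (Fin m × Fin n) K)) =
          Matrix.fromBlocks A (Matrix.of fun a b => X (u (Sum.inl a), v (Sum.inr b)))
        (Matrix.of fun a b => X (u (Sum.inr a), v (Sum.inl b)))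
        (Matrix.of fun a b => X (u (Sum.inr a), v (Sum.inr b))) := by
        ext1 a b
        rcases a with a | a <;> rcases b with b | b <;> rfl
      rw [hM, this]
      refine Ideal.mul_mem_left _ _ (det_mem_pow _ _ fun a b => ?_)
      exact entry_mem (fun a => u (Sum.inl a)) (fun a => u (Sum.inr a)) (fun a => v (Sum.inl a))
        (fun a => v (Sum.inr a)) a b
  · simpa using det_homog (K := K) u v

lemma symb_mul {R : Type*} [CommRing R] [IsNoetherianRing R] (I : Ideal R) [hI : I.IsPrime]
    {a b : ℕ} {f g : R} (hf : f ∈ symbolicPower I a) (hg : g ∈ symbolicPower I b) :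
    f * g ∈ symbolicPower I (a + b) := by
  rw [mem_symb] at *
  obtain ⟨u, hu, hu'⟩ := hf
  obtain ⟨v, hv, hv'⟩ := hg
  refine ⟨u * v, fun h => (hI.mem_or_mem h).elim hu hv, ?_⟩
  rw [mul_mul_mul_comm, pow_add]
  exact Ideal.mul_mem_mul hu' hv'

lemma symb_pow {R : Type*} [CommRing R] [IsNoetherianRing R] (I : Ideal R) [hI : I.IsPrime]
    {a : ℕ} {f : R} (hf : f ∈ symbolicPower I a) (q : ℕ) :
    f ^ q ∈ symbolicPower I (a * q) := by
  induction q with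
  | zero =>
    rw [mem_symb]
    exact ⟨1, fun h => hI.ne_top ((Ideal.eq_top_iff_one _).2 h), by simp⟩
  | succ q ih =>
    rw [pow_succ, mul_add, mul_one]
    exact symb_mul I ih hf

lemma upper {K : Type*} [Field K] [CharZero K] {m r n c s : ℕ} (hc : c + r = m) (hc0 : 0 < c)
    (hmn : m ≤ n) (hs : 1 ≤ s) :
    ∃ D, c * D ≤ c * s + r * (s + c - 1) ∧
      ∃ f ∈ symbolicPower (genericMinors K m n (r + 1)) s, f ≠ 0 ∧ f.IsHomogeneous D := by
  obtain ⟨f, hf, hf0, hfd⟩ := minor_mem (K := K) (m := m) (r := r) (n := n) (j := c) (by omega) hmn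
  have hlt := Nat.mod_lt (s - 1) hc0
  have hdm := Nat.div_add_mod (s - 1) c
  set q := (s - 1) / c
  set ρ := (s - 1) % c
  obtain ⟨g, hg, hg0, hgd⟩ := minor_mem (K := K) (m := m) (r := r) (n := n) (j := ρ + 1)
    (by omega) hmn
  refine ⟨(r + c) * q + (r + (ρ + 1)), ?_, f ^ q * g, ?_, mul_ne_zero (pow_ne_zero _ hf0) hg0,
    (hfd.pow q).mul hgd⟩
  · obtain ⟨s, rfl⟩ : ∃ s', s = s' + 1 := ⟨s - 1, by omega⟩
    simp only [Nat.add_sub_cancel] at hdm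
    have : s + 1 + c - 1 = s + c := by omega
    rw [this, ← hdm]
    have : 0 ≤ r * ρ := Nat.zero_le _
    nlinarith
  · have : s = c * q + (ρ + 1) := by omega
    rw [this]
    exact symb_mul _ (symb_pow _ hf q) hg

end GDet

/-- Theorem 4.1(2): for the generic determinantal ideal `I_t(X)` with `1 < t < m ≤ n` and a
positive integer `N`, the Demailly-type bound, the Chudnovsky-type bound, and `N ≥ m - t + 1`
are equivalent. -/
theorem generic_determinantal_chudnovsky_demailly {K : Type*} [Field K] [CharZero K]
    (m n t : ℕ) (hmn : m ≤ n) (ht1 : 1 < t) (htm : t < m) (N : ℕ) (hN : 0 < N) :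
    ((∀ s r : ℕ, 1 ≤ s → 1 ≤ r →
        (alphaDeg (symbolicPower (genericMinors K m n t) s) : ℝ) / s
          ≥ ((alphaDeg (symbolicPower (genericMinors K m n t) r) : ℝ) + N - 1)
              / ((r : ℝ) + N - 1)) ↔
      (∀ s : ℕ, 1 ≤ s →
        (alphaDeg (symbolicPower (genericMinors K m n t) s) : ℝ) / s
          ≥ ((alphaDeg (genericMinors K m n t) : ℝ) + N - 1) / (N : ℝ))) ∧
    ((∀ s : ℕ, 1 ≤ s →
        (alphaDeg (symbolicPower (genericMinors K m n t) s) : ℝ) / s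
          ≥ ((alphaDeg (genericMinors K m n t) : ℝ) + N - 1) / (N : ℝ)) ↔
      N ≥ m - t + 1) := by
  classical
  obtain ⟨r, rfl⟩ : ∃ r, t = r + 1 := ⟨t - 1, by omega⟩
  obtain ⟨c, hc⟩ : ∃ c, c + r = m := ⟨m - r, by omega⟩
  have hc0 : 0 < c := by omega
  have hcN : m - (r + 1) + 1 = c := by omega
  rw [hcN]
  set I := genericMinors K m n (r + 1) with hI
  set α : ℕ → ℕ := fun s => alphaDeg (symbolicPower I s) with hα
  have hL : ∀ s, 1 ≤ s → m * s ≤ c * α s := by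
    intro s hs
    obtain ⟨D, -, hne⟩ := GDet.upper (K := K) (n := n) hc hc0 hmn hs
    have hmem := Nat.sInf_mem
      (s := {d | ∃ f ∈ symbolicPower I s, f ≠ 0 ∧ MvPolynomial.IsHomogeneous f d}) ⟨D, hne⟩
    obtain ⟨f, hf, h0, hd⟩ := hmem
    exact GDet.lower hc (by omega) f hf h0 hd
  have hU : ∀ s, 1 ≤ s → c * α s ≤ c * s + r * (s + c - 1) := by
    intro s hs
    obtain ⟨D, hD, hne⟩ := GDet.upper (K := K) (n := n) hc hc0 hmn hs
    have : α s ≤ D := Nat.sInf_le hne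
    exact (Nat.mul_le_mul_left c this).trans hD
  have h1 : symbolicPower I 1 = I := by
    ext f
    rw [GDet.mem_symb, pow_one]
    constructor
    · rintro ⟨u, hu, h⟩
      exact ((GDet.prime_minors K m r n).mem_or_mem h).resolve_left hu
    · intro h
      exact ⟨1, fun h => (GDet.prime_minors K m r n).ne_top ((Ideal.eq_top_iff_one _).2 h),
        by simpa using h⟩
  have hα1 : alphaDeg I = α 1 := by rw [hα]; simp only [h1]
  have hαge : r + 1 ≤ α 1 := by
    rw [← hα1]
    obtain ⟨D, -, hne⟩ := GDet.upper (K := K) (n := n) (s := 1) hc hc0 hmn le_rfl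
    have hne' : ∃ f ∈ I, f ≠ 0 ∧ f.IsHomogeneous D := by rw [← h1]; exact hne
    have hmem := Nat.sInf_mem
      (s := {d | ∃ f ∈ I, f ≠ 0 ∧ MvPolynomial.IsHomogeneous f d}) ⟨D, hne'⟩
    obtain ⟨f, hf, h0, hd⟩ := hmem
    exact GDet.alpha_I_ge f hf h0 hd
  rw [hα1]
  have hcR : (0 : ℝ) < c := by exact_mod_cast hc0
  have hNR : (1 : ℝ) ≤ N := by exact_mod_cast hN
  have hrR : (1 : ℝ) ≤ r := by exact_mod_cast (by omega : 1 ≤ r)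
  have hmR : (m : ℝ) = c + r := by rw [← hc]; push_cast; ring
  have hUR : ∀ s : ℕ, 1 ≤ s → (c : ℝ) * α s ≤ c * s + r * (s + c - 1) := by
    intro s hs
    have h := hU s hs
    have h' : ((c * α s : ℕ) : ℝ) ≤ ((c * s + r * (s + c - 1) : ℕ) : ℝ) := by exact_mod_cast h
    rw [Nat.cast_add, Nat.cast_mul, Nat.cast_mul, Nat.cast_mul, Nat.cast_sub (by omega)] at h'
    push_cast at h'
    exact h'
  have hLR : ∀ s : ℕ, 1 ≤ s → ((c : ℝ) + r) * s ≤ c * α s := by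
    intro s hs
    rw [← hmR]
    exact_mod_cast hL s hs
  have hab : (∀ s r : ℕ, 1 ≤ s → 1 ≤ r →
      (α s : ℝ) / s ≥ ((α r : ℝ) + N - 1) / ((r : ℝ) + N - 1)) →
      (∀ s : ℕ, 1 ≤ s → (α s : ℝ) / s ≥ ((α 1 : ℝ) + N - 1) / (N : ℝ)) := by
    intro h s hs
    have := h s 1 hs le_rfl
    have e : ((1 : ℕ) : ℝ) + N - 1 = N := by push_cast; ring
    rwa [e] at this
  have hbc : (∀ s : ℕ, 1 ≤ s → (α s : ℝ) / s ≥ ((α 1 : ℝ) + N - 1) / (N : ℝ)) → N ≥ c := by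
    intro h
    have h2 := h c hc0
    have h4 : ((r : ℝ) + 1) ≤ α 1 := by exact_mod_cast hαge
    rw [ge_iff_le, div_le_div_iff₀ (by linarith) hcR] at h2
    by_contra hlt
    push Not at hlt
    have h5 : (N : ℝ) + 1 ≤ c := by exact_mod_cast hlt
    have h6 : (α c : ℝ) ≤ c + r := by
      have h7 : α c ≤ r + c := Nat.sInf_le (GDet.minor_mem (by omega) hmn)
      have h8 : (α c : ℝ) ≤ ((r + c : ℕ) : ℝ) := by exact_mod_cast h7
      push_cast at h8
      linarith
    have h9 : ((r : ℝ) + N) * c ≤ ((α 1 : ℝ) + N - 1) * c :=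
      mul_le_mul_of_nonneg_right (by linarith) hcR.le
    have h10 : (α c : ℝ) * N ≤ (c + r) * N := mul_le_mul_of_nonneg_right h6 (by linarith)
    nlinarith
  have hca : N ≥ c → (∀ s r : ℕ, 1 ≤ s → 1 ≤ r →
      (α s : ℝ) / s ≥ ((α r : ℝ) + N - 1) / ((r : ℝ) + N - 1)) := by
    intro h s q hs hq
    have hN2 : (c : ℝ) ≤ N := by exact_mod_cast h
    have hsR : (1 : ℝ) ≤ s := by exact_mod_cast hs
    have hqR : (1 : ℝ) ≤ q := by exact_mod_cast hq
    have e1 : ((c : ℝ) + r) / c ≤ (α s : ℝ) / s := by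
      rw [div_le_div_iff₀ hcR (by linarith)]
      linarith [hLR s hs]
    have e2 : ((α q : ℝ) + N - 1) / ((q : ℝ) + N - 1) ≤ ((c : ℝ) + r) / c := by
      rw [div_le_div_iff₀ (by linarith) hcR]
      have := hUR q hq
      nlinarith
    exact e2.trans e1
  exact ⟨⟨hab, fun h => hca (hbc h)⟩, ⟨hbc, fun h => hab (hca h)⟩⟩
end
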